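/- Let K=K(c_1,c_2,c_1) be a symmetric A_3-crystal. For every self-complementary vertex v, the deviation Delta(v) has the form (delta(v),-delta(v)), and a_3(v)=a_1(v)+max{0,delta(v)}; moreover, the map v -> (a_1(v),a_2(v),delta(v),l(v)) is a bijection from S onto the set of integer quadruples (a_1,a_2,delta,l) satisfying 0<=a_1<=c_1, 0<=a_2<=c_2, -a_2<=delta, a_2-c_2<=delta, delta<=c_1-a_1, and 0<=l<=c_2+2*delta. -/

import Mathlib

open Classical

noncomputable section

/-- Iterate a partial operator `k` times. -/
def optIter {V : Type} (f : V → Option V) : ℕ → V → Option V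
  | 0, v => some v
  | k + 1, v => (f v).bind (optIter f k)

/-- A vertex type together with, for every natural number (color) `i`,
a partial operator whose graph is the set of `i`-edges. -/
structure PreGraph where
  V : Type
  F : ℕ → V → Option V

namespace PreGraph

/-- Partial inverse operator of color `i`. -/
def Finv (K : PreGraph) (i : ℕ) (v : K.V) : Option K.V :=
  if h : ∃ u, K.F i u = some v then some h.choose else none

/-- Number of edges of the maximal `i`-colored path beginning at `v`. -/
def h (K : PreGraph) (i : ℕ) (v : K.V) : ℕ :=
  sSup {k | (optIter (K.F i) k v).isSome = true}

/-- Number of edges of the maximal `i`-colored path ending at `v`. -/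
def t (K : PreGraph) (i : ℕ) (v : K.V) : ℕ :=
  sSup {k | ∃ u, optIter (K.F i) k u = some v}

/-- One (undirected) step along an edge of any color. -/
def Step (K : PreGraph) (u v : K.V) : Prop :=
  ∃ i, K.F i u = some v ∨ K.F i v = some u

/-- Weak connectivity. -/
def Connected (K : PreGraph) : Prop :=
  ∀ u v : K.V, Relation.ReflTransGen K.Step u v

/-- All edges have colors in `C`. -/
def ColorsIn (K : PreGraph) (C : Set ℕ) : Prop :=
  ∀ i ∉ C, ∀ v, K.F i v = none

end PreGraph

/-- `s` has no incoming edges. -/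
def IsSource (K : PreGraph) (s : K.V) : Prop := ∀ i u, K.F i u ≠ some s

/-- `tv` has no outgoing edges. -/
def IsSink (K : PreGraph) (tv : K.V) : Prop := ∀ i, K.F i tv = none

/-- `K` is a (finite) colored graph with colors in `C` satisfying axiom (A1):
every connected monochromatic subgraph is a finite directed path. -/
def IsColored (K : PreGraph) (C : Set ℕ) : Prop :=
  Finite K.V ∧ K.ColorsIn C ∧
  (∀ (i : ℕ) (u u' v : K.V), K.F i u = some v → K.F i u' = some v → u = u') ∧
  (∀ (i : ℕ) (v : K.V) (k : ℕ), 0 < k → optIter (K.F i) k v ≠ some v)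

/-- `|i - j| = 1`. -/
def Neighb (i j : ℕ) : Prop := i + 1 = j ∨ j + 1 = i

/-- `|i - j| ≥ 2`. -/
def Far (i j : ℕ) : Prop := i + 2 ≤ j ∨ j + 2 ≤ i

instance (i j : ℕ) : Decidable (Neighb i j) := by unfold Neighb; infer_instance
instance (i j : ℕ) : Decidable (Far i j) := by unfold Far; infer_instance

/-- Axiom (A2) for the ordered pair of distinct colors `(i, j)`. -/
def A2at (K : PreGraph) (i j : ℕ) : Prop :=
  (∀ u v, K.F i u = some v →
    K.t j v ≤ K.t j u ∧ K.h j u ≤ K.h j v ∧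
    ((K.h j u : ℤ) - (K.t j u : ℤ)) - ((K.h j v : ℤ) - (K.t j v : ℤ)) =
      (if Neighb i j then (-1 : ℤ) else 0)) ∧
  (∀ u v w, K.F i u = some v → K.F i v = some w →
    2 * K.h j v ≤ K.h j u + K.h j w)

/-- Axiom (A3) for neighboring colors `i, j`. -/
def A3at (K : PreGraph) (i j : ℕ) : Prop :=
  (∀ u v v', K.F i u = some v → K.F j u = some v' →
    K.h j v = K.h j u →
    ((K.h i v' : ℤ) - (K.h i u : ℤ) = 1 ∧ ∃ w, K.F j v = some w ∧ K.F i v' = some w)) ∧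
  (∀ u u' v, K.F i u = some v → K.F j u' = some v →
    (K.h j v : ℤ) - (K.h j u : ℤ) = 1 →
    (K.h i v = K.h i u' ∧ ∃ w, K.F j w = some u ∧ K.F i w = some u'))

/-- Axiom (A4) (Verma relations) for neighboring colors `i, j`. -/
def A4at (K : PreGraph) (i j : ℕ) : Prop :=
  (∀ u v v', K.F i u = some v → K.F j u = some v' →
    (K.h j v : ℤ) - (K.h j u : ℤ) = 1 → (K.h i v' : ℤ) - (K.h i u : ℤ) = 1 →
    ∃ w, (((K.F i u).bind (K.F j)).bind (K.F j)).bind (K.F i) = some w ∧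
         (((K.F j u).bind (K.F i)).bind (K.F i)).bind (K.F j) = some w) ∧
  (∀ u u' v, K.F i u = some v → K.F j u' = some v →
    K.h j v = K.h j u → K.h i v = K.h i u' →
    ∃ w, (((K.Finv i v).bind (K.Finv j)).bind (K.Finv j)).bind (K.Finv i) = some w ∧
         (((K.Finv j v).bind (K.Finv i)).bind (K.Finv i)).bind (K.Finv j) = some w)

/-- Axiom (A5) for colors `i, j` at distance at least 2. -/
def A5at (K : PreGraph) (i j : ℕ) : Prop :=
  ∀ Fi ∈ ({K.F i, K.Finv i} : Set (K.V → Option K.V)),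
  ∀ Fj ∈ ({K.F j, K.Finv j} : Set (K.V → Option K.V)),
  ∀ v, (Fi v).isSome → (Fj v).isSome →
    ∃ w, (Fi v).bind Fj = some w ∧ (Fj v).bind Fi = some w

/-- `K` is a regular crystal of type A on the color set `C`
(an `A_{|C|}`-crystal when `C` is an integer interval). -/
def IsCrystalOn (K : PreGraph) (C : Set ℕ) : Prop :=
  IsColored K C ∧ K.Connected ∧
  (∀ i ∈ C, ∀ j ∈ C, i ≠ j → A2at K i j) ∧
  (∀ i ∈ C, ∀ j ∈ C, Neighb i j → A3at K i j ∧ A4at K i j) ∧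
  (∀ i ∈ C, ∀ j ∈ C, Far i j → A5at K i j)

/-- `K` is an `A_n`-crystal (colors `1, …, n`). -/
def IsACrystal (n : ℕ) (K : PreGraph) : Prop := IsCrystalOn K (Set.Icc 1 n)

/-- Apply a list of operators, head first. -/
def applyStr (K : PreGraph) : List ℕ → K.V → Option K.V
  | [], v => some v
  | i :: L, v => (K.F i v).bind (applyStr K L)

/-- The string `w_{m,k,j} = F_{o+j} F_{o+j+1} ⋯ F_{o+j+k-1}` (rightmost applied
first, i.e. head of the list applied first) for a crystal with colors `o+1, …, o+m`. -/
def wStr (o k j : ℕ) : List ℕ := (List.range k).map (fun m => o + j + k - 1 - m)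

/-- The string `S_{m,k} = w_{m,k,m-k+1} ⋯ w_{m,k,2} w_{m,k,1}` for a crystal with
colors `o+1, …, o+m`. -/
def SStr (o m k : ℕ) : List ℕ :=
  (List.range (m - k + 1)).flatMap fun jm => wStr o k (jm + 1)

/-- The string `S_{m,m}^{a_{o+m}} ⋯ S_{m,1}^{a_{o+1}}` for a crystal with colors
`o+1, …, o+m`, defining the principal vertex with coordinates `a`. -/
def prinStr (o m : ℕ) (a : ℕ → ℕ) : List ℕ :=
  (List.range m).flatMap fun km => (List.replicate (a (o + km + 1)) (SStr o m (km + 1))).flatten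

def prinOpt (K : PreGraph) (o m : ℕ) (s : K.V) (a : ℕ → ℕ) : Option K.V :=
  applyStr K (prinStr o m a) s

/-- `p` is the principal vertex with coordinates `a` of the crystal `K` with colors
`o+1, …, o+m` and source `s`. -/
def IsPrin (K : PreGraph) (o m : ℕ) (s : K.V) (a : ℕ → ℕ) (p : K.V) : Prop :=
  prinOpt K o m s a = some p

/-- The principal lattice of an `A_n`-crystal with source `s` and parameter `c`. -/
def PrinLat (K : PreGraph) (n : ℕ) (s : K.V) (c : ℕ → ℕ) : Set K.V :=
  {p | ∃ a : ℕ → ℕ, (∀ i, 1 ≤ i → i ≤ n → a i ≤ c i) ∧ IsPrin K 0 n s a p}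

/-- One undirected step along an edge with color in `I`. -/
def stepOn (K : PreGraph) (I : Set ℕ) (u v : K.V) : Prop :=
  ∃ i ∈ I, K.F i u = some v ∨ K.F i v = some u

/-- `u` lies in the same `I`-colored component as `v`. -/
def inComp (K : PreGraph) (I : Set ℕ) (v u : K.V) : Prop :=
  Relation.ReflTransGen (stepOn K I) v u

/-- The subcrystal of `K` with color set `I` containing `v` (the maximal connected
subgraph through `v` using only colors in `I`). -/
def PreGraph.sub (K : PreGraph) (I : Set ℕ) (v : K.V) : PreGraph where
  V := {u : K.V // inComp K I v u}
  F := fun i u =>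
    if hi : i ∈ I then
      (K.F i u.1).pbind fun w hw =>
        some ⟨w, Relation.ReflTransGen.tail u.2 ⟨i, hi, Or.inl (Option.mem_def.mp hw)⟩⟩
    else none

/-- Directed reachability. -/
def dirReach (K : PreGraph) (u v : K.V) : Prop :=
  Relation.ReflTransGen (fun a b => ∃ i, K.F i a = some b) u v

/-- The interval of `K` from `p` to `q`: the subgraph formed by all vertices and
edges lying on directed paths from `p` to `q`. -/
def PreGraph.interval (K : PreGraph) (p q : K.V) : PreGraph where
  V := {w : K.V // dirReach K p w ∧ dirReach K w q}
  F := fun i u =>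
    (K.F i u.1).pbind fun w _ =>
      if hw : dirReach K p w ∧ dirReach K w q then some ⟨w, hw⟩ else none

/-- The symmetric extract: restriction to self-complementary vertices,
with `ibar`-edges given by `chain i`. -/
def extract (K : PreGraph) (chain : ℕ → K.V → Option K.V) (σ : K.V → K.V) : PreGraph where
  V := {v : K.V // σ v = v}
  F := fun i u =>
    (chain i u.1).pbind fun w _ => if hw : σ w = w then some ⟨w, hw⟩ else none

/-- The operator chain for the color `ibar` of the symmetric extract of a
symmetric `A_{2n-1}`-crystal. -/
def chainB (K : PreGraph) (n : ℕ) (i : ℕ) (u : K.V) : Option K.V :=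
  if 1 ≤ i ∧ i ≤ n then
    (if i = n then K.F n u else (K.F i u).bind (K.F (2 * n - i)))
  else none

/-- The operator chain for the color `ibar` of the symmetric extract of a
symmetric `A_{2n}`-crystal. -/
def chainC (K : PreGraph) (n : ℕ) (i : ℕ) (u : K.V) : Option K.V :=
  if 1 ≤ i ∧ i ≤ n then
    (if i = n then (((K.F n u).bind (K.F (n + 1))).bind (K.F (n + 1))).bind (K.F n)
     else (K.F i u).bind (K.F (2 * n + 1 - i)))
  else none

/-- Symmetric extract from a symmetric `A_{2n-1}`-crystal. -/
def extractB (K : PreGraph) (n : ℕ) (σ : K.V → K.V) : PreGraph := extract K (chainB K n) σ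

/-- Symmetric extract from a symmetric `A_{2n}`-crystal. -/
def extractC (K : PreGraph) (n : ℕ) (σ : K.V → K.V) : PreGraph := extract K (chainC K n) σ

/-- Admissibility of a six-tuple `(x', y, x''; y', x, y'')` in the worm model. -/
def WormOK (g1 g2 : ℕ) : ℤ × ℤ × ℤ × ℤ × ℤ × ℤ → Prop
  | (x', y, x'', y', x, y'') =>
    (0 ≤ x' ∧ x' ≤ 2 * (g1 : ℤ)) ∧ (0 ≤ x'' ∧ x'' ≤ 2 * (g1 : ℤ)) ∧
    (0 ≤ x ∧ x ≤ 2 * (g1 : ℤ)) ∧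
    (0 ≤ y' ∧ y' ≤ (g2 : ℤ)) ∧ (0 ≤ y'' ∧ y'' ≤ (g2 : ℤ)) ∧ (0 ≤ y ∧ y ≤ (g2 : ℤ)) ∧
    (2 ∣ x') ∧ (2 ∣ x'') ∧ (y' ≤ y ∧ y ≤ y'') ∧ (x' ≤ x ∧ x ≤ x'') ∧
    (y' < y → x' = x) ∧ (y < y'' → x = x'')

/-- The candidate image of a worm under the operator `1tilde`. -/
def worm1 : ℤ × ℤ × ℤ × ℤ × ℤ × ℤ → ℤ × ℤ × ℤ × ℤ × ℤ × ℤ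
  | (x', y, x'', y', x, y'') =>
    if 2 * x > x' + x'' then (x' + 2, y, x'', y', x, y'')
    else if x = x' ∧ x' = x'' ∧ y < y'' then (x', y + 1, x'', y', x, y'')
    else (x', y, x'' + 2, y', x, y'')

/-- The candidate image of a worm under the operator `2tilde`. -/
def worm2 : ℤ × ℤ × ℤ × ℤ × ℤ × ℤ → ℤ × ℤ × ℤ × ℤ × ℤ × ℤ
  | (x', y, x'', y', x, y'') =>
    if 2 * y > y' + y'' then (x', y, x'', y' + 1, x, y'')
    else if y' = y ∧ y = y'' ∧ x < x'' then (x', y, x'', y', x + 1, y'')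
    else (x', y, x'', y', x, y'' + 1)

/-- The worm graph `W(g1, g2)`, with colors `1 = 1tilde` and `2 = 2tilde`. -/
def WormGraph (g1 g2 : ℕ) : PreGraph where
  V := {w : ℤ × ℤ × ℤ × ℤ × ℤ × ℤ // WormOK g1 g2 w}
  F := fun i u =>
    if i = 1 then
      (if h1 : WormOK g1 g2 (worm1 u.1) then some ⟨worm1 u.1, h1⟩ else none)
    else if i = 2 then
      (if h2 : WormOK g1 g2 (worm2 u.1) then some ⟨worm2 u.1, h2⟩ else none)
    else none

/-- Isomorphism of colored graphs, renaming colors via `φ`. -/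
def IsoVia (K L : PreGraph) (φ : ℕ → ℕ) : Prop :=
  ∃ e : K.V ≃ L.V, ∀ i u v, K.F i u = some v ↔ L.F (φ i) (e u) = some (e v)

/-- The Cartesian product of an `i`-path of length `p` and a `j`-path of length `q`. -/
def boxGraph (i j p q : ℕ) : PreGraph where
  V := Fin (p + 1) × Fin (q + 1)
  F := fun s u =>
    if s = i then
      (if h : (u.1 : ℕ) < p then some (⟨(u.1 : ℕ) + 1, by omega⟩, u.2) else none)
    else if s = j then
      (if h : (u.2 : ℕ) < q then some (u.1, ⟨(u.2 : ℕ) + 1, by omega⟩) else none)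
    else none

/-- `B_n`-crystal: components with colors `n-1, n` are worm graphs,
with color `n-1` corresponding to `1tilde` and `n` to `2tilde`. -/
def IsBCrystal (n : ℕ) (B : PreGraph) : Prop :=
  IsColored B (Set.Icc 1 n) ∧ B.Connected ∧
  (∀ i ∈ Set.Icc 1 n, ∀ j ∈ Set.Icc 1 n, Far i j → A5at B i j) ∧
  (∀ i j, 1 ≤ i → i < n → 1 ≤ j → j < n → Neighb i j →
    ∀ v : B.V, IsCrystalOn (B.sub {i, j} v) {i, j}) ∧
  (∀ v : B.V, ∃ g1 g2 : ℕ,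
    IsoVia (B.sub ({n - 1, n} : Set ℕ) v) (WormGraph g1 g2)
      (fun x => if x = n - 1 then 1 else if x = n then 2 else 0))

/-- `C_n`-crystal: components with colors `n-1, n` are worm graphs,
with color `n-1` corresponding to `2tilde` and `n` to `1tilde`. -/
def IsCCrystal (n : ℕ) (B : PreGraph) : Prop :=
  IsColored B (Set.Icc 1 n) ∧ B.Connected ∧
  (∀ i ∈ Set.Icc 1 n, ∀ j ∈ Set.Icc 1 n, Far i j → A5at B i j) ∧
  (∀ i j, 1 ≤ i → i < n → 1 ≤ j → j < n → Neighb i j →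
    ∀ v : B.V, IsCrystalOn (B.sub {i, j} v) {i, j}) ∧
  (∀ v : B.V, ∃ g1 g2 : ℕ,
    IsoVia (B.sub ({n - 1, n} : Set ℕ) v) (WormGraph g1 g2)
      (fun x => if x = n - 1 then 2 else if x = n then 1 else 0))

/-! ### The crossing model -/

/-- `(k, i, j)` is a node `v_i^k(j)` of the supporting graph `G` for rank `n`. -/
def isNode (n k i j : ℕ) : Prop :=
  1 ≤ j ∧ j ≤ i ∧ i ≤ n ∧ i - j + 1 ≤ k ∧ k ≤ n - j + 1

instance (n k i j : ℕ) : Decidable (isNode n k i j) := by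
  unfold isNode; infer_instance

/-- Extension of a function on the nodes of `G` to the extended supporting graph:
extra nodes from which `G^k` is reachable get value `c k`, the others get `0`. -/
def fext (n : ℕ) (c : ℕ → ℕ) (f : ℕ × ℕ × ℕ → ℤ) (k i j : ℕ) : ℤ :=
  if isNode n k i j then f (k, i, j)
  else if j ≤ n - k + 1 then (c k : ℤ) else 0

/-- The slack at the node `v_i^k(j)`. -/
def epsN (n : ℕ) (c : ℕ → ℕ) (f : ℕ × ℕ × ℕ → ℤ) (k i j : ℕ) : ℤ :=
  (fext n c f k (i - 1) (j - 1) - fext n c f k i j) -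
    (fext n c f k i (j - 1) - fext n c f k (i + 1) j)

/-- The total slack at the multinode `V_i(j)`. -/
def epsTot (n : ℕ) (c : ℕ → ℕ) (f : ℕ × ℕ × ℕ → ℤ) (i j : ℕ) : ℤ :=
  ∑ k ∈ Finset.Icc (i - j + 1) (n - j + 1), epsN n c f k i j

/-- The reduced slack at the multinode `V_i(j)`. -/
def teps (n : ℕ) (c : ℕ → ℕ) (f : ℕ × ℕ × ℕ → ℤ) (i j : ℕ) : ℤ :=
  if hj : (Finset.Icc 1 j).Nonempty then
    max 0 ((Finset.Icc 1 j).inf' hj fun p => ∑ q ∈ Finset.Icc p j, epsTot n c f i q)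
  else 0

/-- `k0` satisfies the switch condition in the multinode `V_i(j)`. -/
def switchCond (n : ℕ) (f : ℕ × ℕ × ℕ → ℤ) (i j k0 : ℕ) : Prop :=
  i - j + 1 ≤ k0 ∧ k0 ≤ n - j + 1 ∧
  (∀ k, i - j + 1 ≤ k → k < k0 → isNode n k (i + 1) (j + 1) →
    f (k, i, j) = f (k, i + 1, j + 1)) ∧
  (∀ k, k0 < k → k ≤ n - j + 1 → isNode n k (i + 1) j →
    f (k, i + 1, j) = f (k, i, j))

/-- The switch-node (first node with the switch property) of the multinode `V_i(j)`. -/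
def switchNode (n : ℕ) (f : ℕ × ℕ × ℕ → ℤ) (i j : ℕ) : ℕ :=
  sInf {k0 | switchCond n f i j k0}

/-- Feasible functions of the crossing model (normalized to vanish off the nodes). -/
def Feasible (n : ℕ) (c : ℕ → ℕ) (f : ℕ × ℕ × ℕ → ℤ) : Prop :=
  (∀ k i j, ¬ isNode n k i j → f (k, i, j) = 0) ∧
  (∀ k i j, isNode n k i j → isNode n k (i - 1) j → f (k, i - 1, j) ≤ f (k, i, j)) ∧
  (∀ k i j, isNode n k i j → isNode n k (i + 1) (j + 1) → f (k, i + 1, j + 1) ≤ f (k, i, j)) ∧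
  (∀ k i j, isNode n k i j → 0 ≤ f (k, i, j) ∧ f (k, i, j) ≤ (c k : ℤ)) ∧
  (∀ i j, 1 ≤ j → j ≤ i → i ≤ n → ∃ k0, switchCond n f i j k0)

/-- Increase `f` by one at the node `(k, i, j)`. -/
def bump (f : ℕ × ℕ × ℕ → ℤ) (k i j : ℕ) : ℕ × ℕ × ℕ → ℤ :=
  fun x => if x = (k, i, j) then f x + 1 else f x

/-- The crossing-model graph `Kscr(c)`: vertices are the feasible functions, and
the move `φ_i` increases `f` by one at the switch-node of the active multinode. -/
def Kscr (n : ℕ) (c : ℕ → ℕ) : PreGraph where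
  V := {f : ℕ × ℕ × ℕ → ℤ // Feasible n c f}
  F := fun i f =>
    if 1 ≤ i ∧ i ≤ n ∧ ∃ j, 1 ≤ j ∧ j ≤ i ∧ 0 < teps n c f.1 i j then
      (let j := sSup {j | 1 ≤ j ∧ j ≤ i ∧ 0 < teps n c f.1 i j}
       let g := bump f.1 (switchNode n f.1 i j) i j
       if hg : Feasible n c g then some ⟨g, hg⟩ else none)
    else none

/-- The function `f_{a,D}` of the crossing model. -/
def faD (n : ℕ) (a : ℕ → ℕ) (D : ℕ → ℤ) : ℕ × ℕ × ℕ → ℤ := fun x =>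
  if isNode n x.1 x.2.1 x.2.2 then
    (if x.2.1 - x.2.2 + 1 = x.1 then (a x.1 : ℤ) else (a x.1 : ℤ) + min (D (x.1 - 1)) 0) +
    (if x.2.2 ≤ n - x.1 then max (D x.1) 0 else 0)
  else 0

/-! ### Descriptions of self-complementary vertices -/

/-- `(a1, a2, δ, l)` is the description of a self-complementary vertex `v` of a
symmetric `A_3`-crystal `K` with source `s` and parameter `c`. -/
def IsDescB (K : PreGraph) (s : K.V) (c : ℕ → ℕ) (v : K.V) (q : ℕ × ℕ × ℤ × ℕ) : Prop :=
  q.2.2.2 = K.t 2 v ∧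
  ∃ (a : ℕ → ℕ) (pa : K.V),
    a 1 = q.1 ∧ a 2 = q.2.1 ∧ a 3 = ((q.1 : ℤ) + max q.2.2.1 0).toNat ∧
    (∀ i, 1 ≤ i → i ≤ 3 → a i ≤ c i) ∧
    IsPrin K 0 3 s a pa ∧ inComp K (Set.Icc 1 2) pa v ∧
    0 ≤ (q.2.1 : ℤ) + q.2.2.1 ∧ 0 ≤ (a 3 : ℤ) - q.2.2.1 ∧
    ∃ s' : (K.sub (Set.Icc 1 2) pa).V, IsSource (K.sub (Set.Icc 1 2) pa) s' ∧
    ∃ z : (K.sub (Set.Icc 1 2) pa).V,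
      IsPrin (K.sub (Set.Icc 1 2) pa) 0 2 s'
        (fun i => if i = 1 then ((q.2.1 : ℤ) + q.2.2.1).toNat else ((a 3 : ℤ) - q.2.2.1).toNat) z ∧
      inComp K ({2} : Set ℕ) z.1 v

/-- The polytope of descriptions for a symmetric `A_3`-crystal with parameter `(c1, c2, c1)`. -/
def QuadB (c1 c2 : ℕ) : Set (ℕ × ℕ × ℤ × ℕ) :=
  {q | q.1 ≤ c1 ∧ q.2.1 ≤ c2 ∧ -(q.2.1 : ℤ) ≤ q.2.2.1 ∧ (q.2.1 : ℤ) - (c2 : ℤ) ≤ q.2.2.1 ∧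
       q.2.2.1 ≤ (c1 : ℤ) - (q.1 : ℤ) ∧ (q.2.2.2 : ℤ) ≤ (c2 : ℤ) + 2 * q.2.2.1}

/-- The worm associated to the description `(a1, a2, δ, l)`. -/
def wtupleB (a1 a2 : ℕ) (δ : ℤ) (l : ℕ) : ℤ × ℤ × ℤ × ℤ × ℤ × ℤ :=
  let a3 : ℤ := (a1 : ℤ) + max δ 0
  let tr : ℤ × ℤ × ℤ :=
    if 0 ≤ δ then
      if (l : ℤ) ≤ (a2 : ℤ) then ((l : ℤ), 2 * (a1 : ℤ), (a2 : ℤ))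
      else if (l : ℤ) ≤ (a2 : ℤ) + 2 * δ then
        ((a2 : ℤ), 2 * (a1 : ℤ) + (l : ℤ) - (a2 : ℤ), (a2 : ℤ))
      else ((a2 : ℤ), 2 * a3, (l : ℤ) - 2 * δ)
    else
      if (l : ℤ) ≤ (a2 : ℤ) + δ then ((l : ℤ), 2 * (a1 : ℤ), (a2 : ℤ) - δ)
      else ((a2 : ℤ) + δ, 2 * (a1 : ℤ), (l : ℤ) - 2 * δ)
  (2 * (a1 : ℤ), (a2 : ℤ), 2 * a3, tr.1, tr.2.1, tr.2.2)

def wtQ (q : ℕ × ℕ × ℤ × ℕ) : ℤ × ℤ × ℤ × ℤ × ℤ × ℤ :=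
  wtupleB q.1 q.2.1 q.2.2.1 q.2.2.2

/-- The string `(F_2 F_3)^r (F_3 F_2)^r` (rightmost applied first). -/
def diagStr (r : ℕ) : List ℕ :=
  (List.replicate r ([2, 3] : List ℕ)).flatten ++ (List.replicate r ([3, 2] : List ℕ)).flatten

/-- `(a1, a2, δ, ρ)` is the description of a self-complementary vertex `v` of a
symmetric `A_4`-crystal `K` with source `s` and parameter `c`. -/
def IsDescC (K : PreGraph) (s : K.V) (c : ℕ → ℕ) (v : K.V) (q : ℕ × ℕ × ℤ × ℕ) : Prop :=
  ∃ (a : ℕ → ℕ) (pa : K.V),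
    a 1 = q.1 ∧ a 2 = q.2.1 ∧ a 3 = ((q.2.1 : ℤ) + min q.2.2.1 0).toNat ∧
    a 4 = ((q.1 : ℤ) + max q.2.2.1 0).toNat ∧
    (∀ i, 1 ≤ i → i ≤ 4 → a i ≤ c i) ∧
    IsPrin K 0 4 s a pa ∧ inComp K (Set.Icc 1 3) pa v ∧
    0 ≤ (q.2.1 : ℤ) + q.2.2.1 ∧ 0 ≤ (a 4 : ℤ) - q.2.2.1 ∧
    (∃ s' : (K.sub (Set.Icc 1 3) pa).V, IsSource (K.sub (Set.Icc 1 3) pa) s' ∧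
     ∃ z : (K.sub (Set.Icc 1 3) pa).V,
       IsPrin (K.sub (Set.Icc 1 3) pa) 0 3 s'
         (fun i => if i = 1 then ((q.2.1 : ℤ) + q.2.2.1).toNat
                   else if i = 2 then a 3 else ((a 4 : ℤ) - q.2.2.1).toNat) z ∧
       inComp K (Set.Icc 2 3) z.1 v) ∧
    (∃ stil : (K.sub (Set.Icc 2 3) v).V, IsSource (K.sub (Set.Icc 2 3) v) stil ∧
       applyStr (K.sub (Set.Icc 2 3) v) (diagStr q.2.2.2) stil =
         some ⟨v, Relation.ReflTransGen.refl⟩)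

/-- The polytope of descriptions for a symmetric `A_4`-crystal with parameter
`(c1, c2, c2, c1)`. -/
def QuadC (c1 c2 : ℕ) : Set (ℕ × ℕ × ℤ × ℕ) :=
  {q | q.1 ≤ c1 ∧ q.2.1 ≤ c2 ∧ -(q.2.1 : ℤ) ≤ q.2.2.1 ∧
       q.2.2.1 ≤ (c1 : ℤ) - (q.1 : ℤ) ∧ (q.2.2.2 : ℤ) ≤ (c2 : ℤ) + q.2.2.1}

end

/-! ### Regular crystals of rank three through their axioms -/

/-- `i` is one of the colors `1, 2, 3`. -/
def Col (i : ℕ) : Prop := 1 ≤ i ∧ i ≤ 3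

/-- `v` is obtained from `s` by a directed path with `n` edges. -/
inductive Reach (G : PreGraph) (s : G.V) : ℕ → G.V → Prop
  | base : Reach G s 0 s
  | step {n : ℕ} {u v : G.V} (i : ℕ) : Reach G s n u → G.F i u = some v → Reach G s (n + 1) v

/-- `u` and `m` are the ends of two directed paths with the same sequence of `n` colors,
starting at `s` and `s'`. -/
inductive Paired (G H : PreGraph) (s : G.V) (s' : H.V) : ℕ → G.V → H.V → Prop
  | base : Paired G H s s' 0 s s'
  | step {n : ℕ} {u v : G.V} {m p : H.V} (i : ℕ) : Paired G H s s' n u m →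
      G.F i u = some v → H.F i m = some p → Paired G H s s' (n + 1) v p

/-- The crystal axioms for colors `1, 2, 3`, with string lengths `h`, `t` given as functions. -/
structure Axioms (G : PreGraph) (h t : ℕ → G.V → ℤ) : Prop where
  col : ∀ {i u v}, G.F i u = some v → Col i
  inj : ∀ {i u u' v}, G.F i u = some v → G.F i u' = some v → u = u'
  hpos : ∀ {i u}, Col i → 0 < h i u → ∃ v, G.F i u = some v
  tpos : ∀ {i v}, Col i → 0 < t i v → ∃ u, G.F i u = some v
  hnn : ∀ {i u}, Col i → 0 ≤ h i u
  tnn : ∀ {i u}, Col i → 0 ≤ t i u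
  hstep : ∀ {i u v}, G.F i u = some v → h i v = h i u - 1
  tstep : ∀ {i u v}, G.F i u = some v → t i v = t i u + 1
  near : ∀ {i j u v}, G.F i u = some v → Col j → Neighb i j →
    h j v - t j v = h j u - t j u + 1 ∧ h j u ≤ h j v ∧ t j v ≤ t j u
  far : ∀ {i j u v}, G.F i u = some v → Col j → Far i j → h j v = h j u ∧ t j v = t j u
  square : ∀ {i j u v v'}, G.F i u = some v → G.F j u = some v' → Neighb i j → h j v = h j u →
    h i v' = h i u + 1 ∧ ∃ w, G.F j v = some w ∧ G.F i v' = some w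
  square_dual : ∀ {i j u u' v}, G.F i u = some v → G.F j u' = some v → Neighb i j →
    h j v = h j u + 1 → h i v = h i u' ∧ ∃ w, G.F j w = some u ∧ G.F i w = some u'
  verma : ∀ {i j u v v'}, G.F i u = some v → G.F j u = some v' → Neighb i j →
    h j v = h j u + 1 → h i v' = h i u + 1 →
    ∃ x₂ x₃ y₂ y₃ w, G.F j v = some x₂ ∧ G.F j x₂ = some x₃ ∧ G.F i x₃ = some w ∧
      G.F i v' = some y₂ ∧ G.F i y₂ = some y₃ ∧ G.F j y₃ = some w
  verma_dual : ∀ {i j u u' v}, G.F i u = some v → G.F j u' = some v → Neighb i j →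
    h j v = h j u → h i v = h i u' →
    ∃ w x₁ x₂ y₁ y₂, G.F i w = some x₁ ∧ G.F j x₁ = some x₂ ∧ G.F j x₂ = some u ∧
      G.F j w = some y₁ ∧ G.F i y₁ = some y₂ ∧ G.F i y₂ = some u'
  commute : ∀ {i j u v v'}, G.F i u = some v → G.F j u = some v' → Far i j →
    ∃ w, G.F j v = some w ∧ G.F i v' = some w
  commute_dual : ∀ {i j u u' v}, G.F i u = some v → G.F j u' = some v → Far i j →
    ∃ w, G.F j w = some u ∧ G.F i w = some u'

lemma neighb_symm {i j : ℕ} (hij : Neighb i j) : Neighb j i := by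
  unfold Neighb at *; omega

lemma col_trichotomy (i j : ℕ) : i = j ∨ Neighb i j ∨ Far i j := by
  unfold Neighb Far; omega

section Uniqueness

variable {G H : PreGraph} {h t : ℕ → G.V → ℤ} {h' t' : ℕ → H.V → ℤ} {s : G.V} {s' : H.V}

/-- Twice the pairing of the weight of `v` with the sum of the fundamental coweights. -/
def height (h t : ℕ → G.V → ℤ) (v : G.V) : ℤ :=
  3 * (h 1 v - t 1 v) + 4 * (h 2 v - t 2 v) + 3 * (h 3 v - t 3 v)

lemma Axioms.height_step (A : Axioms G h t) {i : ℕ} {u v : G.V} (e : G.F i u = some v) :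
    height h t v = height h t u - 2 := by
  have a1 := A.hstep e
  have a2 := A.tstep e
  have near := fun j => A.near (j := j) e
  have far := fun j => A.far (j := j) e
  have hi := A.col e
  unfold Col at *
  have hi' : i = 1 ∨ i = 2 ∨ i = 3 := by omega
  unfold height
  rcases hi' with rfl | rfl | rfl
  · have := near 2 (by simp) (by simp [Neighb])
    have := far 3 (by simp) (by simp [Far])
    omega
  · have := near 1 (by simp) (by simp [Neighb])
    have := near 3 (by simp) (by simp [Neighb])
    omega
  · have := near 2 (by simp) (by simp [Neighb])
    have := far 1 (by simp) (by simp [Far])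
    omega

lemma Axioms.height_reach (A : Axioms G h t) {n : ℕ} {v : G.V} (r : Reach G s n v) :
    height h t v = height h t s - 2 * n := by
  induction r with
  | base => simp
  | step i _ e ih => rw [A.height_step e, ih]; push_cast; ring

lemma Axioms.reach_unique (A : Axioms G h t) {n k : ℕ} {v : G.V} (r : Reach G s n v)
    (r' : Reach G s k v) : n = k := by
  have := A.height_reach r
  have := A.height_reach r'
  omega

lemma Paired.symm {n : ℕ} {u : G.V} {m : H.V} (p : Paired G H s s' n u m) :
    Paired H G s' s n m u := by
  induction p with
  | base => exact .base
  | step i _ e e' ih => exact .step i ih e' e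

lemma Paired.reach {n : ℕ} {u : G.V} {m : H.V} (p : Paired G H s s' n u m) :
    Reach G s n u := by
  induction p with
  | base => exact .base
  | step i _ e _ ih => exact .step i ih e

/-- String lengths agree on paired vertices at depth at most `n`. -/
def Agree (G H : PreGraph) (s : G.V) (s' : H.V) (h t : ℕ → G.V → ℤ) (h' t' : ℕ → H.V → ℤ)
    (n : ℕ) : Prop :=
  ∀ k u m, k ≤ n → Paired G H s s' k u m → ∀ i, Col i → h i u = h' i m ∧ t i u = t' i m

/-- At depth at most `n`, the second of two paired vertices is determined by the first one. -/
def Functional (G H : PreGraph) (s : G.V) (s' : H.V) (n : ℕ) : Prop :=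
  ∀ k u m m', k ≤ n → Paired G H s s' k u m → Paired G H s s' k u m' → m = m'

lemma Agree.symm {n : ℕ} (a : Agree G H s s' h t h' t' n) : Agree H G s' s h' t' h t n := by
  intro k u m hk p i hi
  have := a k m u hk p.symm i hi
  exact ⟨this.1.symm, this.2.symm⟩

lemma Agree.lift (A : Axioms G h t) (B : Axioms H h' t') {n : ℕ}
    (a : Agree G H s s' h t h' t' n) {k i : ℕ} {u v : G.V} {m : H.V} (hk : k ≤ n)
    (p : Paired G H s s' k u m) (e : G.F i u = some v) :
    ∃ m', H.F i m = some m' ∧ Paired G H s s' (k + 1) v m' := by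
  have h0 := (a k u m hk p i (A.col e)).1
  have h1 := A.hstep e
  have h2 := A.hnn (u := v) (A.col e)
  obtain ⟨m', e'⟩ := B.hpos (u := m) (A.col e) (by omega)
  exact ⟨m', e', .step i p e e'⟩

lemma Agree.exists_paired (A : Axioms G h t) (B : Axioms H h' t') {n : ℕ}
    (a : Agree G H s s' h t h' t' n) {k : ℕ} {u : G.V} (r : Reach G s k u) (hk : k ≤ n + 1) :
    ∃ m, Paired G H s s' k u m := by
  induction r with
  | base => exact ⟨_, .base⟩
  | step i _ e ih =>
    obtain ⟨m, p⟩ := ih (by omega)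
    obtain ⟨m', -, p'⟩ := a.lift A B (by omega) p e
    exact ⟨m', p'⟩

lemma Axioms.reach_pred (A : Axioms G h t) (hr : ∀ v, ∃ n, Reach G s n v) {k i : ℕ}
    {u w : G.V} (r : Reach G s k u) (e : G.F i w = some u) :
    ∃ k', k = k' + 1 ∧ Reach G s k' w := by
  obtain ⟨k', r'⟩ := hr w
  exact ⟨k', A.reach_unique r (.step i r' e), r'⟩

/-- The predecessors of a vertex with two incoming edges of neighboring colors labeled `0`
stem from a vertex whose two outgoing edges are labeled `1`. -/
lemma Axioms.verma_label (A : Axioms G h t) {i j : ℕ} (hij : Neighb i j)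
    {u u' v w x₁ x₂ y₁ y₂ : G.V} (e : G.F i u = some v) (e' : G.F j u' = some v)
    (hj : h j v = h j u) (hi : h i v = h i u')
    (e₁ : G.F i w = some x₁) (e₂ : G.F j x₁ = some x₂) (e₃ : G.F j x₂ = some u)
    (f₁ : G.F j w = some y₁) (f₂ : G.F i y₁ = some y₂) (f₃ : G.F i y₂ = some u') :
    h j x₁ = h j w + 1 := by
  obtain ⟨n1, n2, n3⟩ := A.near e₁ (A.col f₁) hij
  by_contra hne
  have h0 : h j x₁ = h j w := by omega
  obtain ⟨-, x, q1, q2⟩ := A.square e₁ f₁ hij h0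
  obtain rfl : x₂ = x := by rw [e₂] at q1; exact Option.some.inj q1
  obtain rfl : y₂ = x₂ := by rw [f₂] at q2; exact Option.some.inj q2
  have b1 := A.hstep e
  have b2 := A.hstep e'
  have b3 := A.hstep e₃
  have b4 := A.hstep f₃
  have := (A.square f₃ e₃ hij (by omega)).1
  omega

lemma functional_succ (A : Axioms G h t) (B : Axioms H h' t')
    (hr : ∀ v, ∃ n, Reach G s n v) {n : ℕ}
    (a : Agree G H s s' h t h' t' n) (f : Functional G H s s' n) {v : G.V} {m m' : H.V}
    (p : Paired G H s s' (n + 1) v m) (p' : Paired G H s s' (n + 1) v m') : m = m' := by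
  cases p with
  | step i q e g =>
  rename_i u r
  cases p' with
  | step j q' e' g' =>
  rename_i u' r'
  have square_case : ∀ w, G.F j w = some u → G.F i w = some u' →
      (∀ k y, k ≤ n → Paired G H s s' k w y → H.F j y = some r → H.F i y = some r' →
        ∃ z, H.F i r = some z ∧ H.F j r' = some z) → m = m' := by
    intro w w1 w2 key
    obtain ⟨k, rfl, rk⟩ := A.reach_pred hr q.reach w1
    obtain ⟨y, py⟩ := a.exists_paired A B rk (by omega)
    obtain ⟨y1, ey1, py1⟩ := a.lift A B (by omega) py w1
    obtain ⟨y2, ey2, py2⟩ := a.lift A B (by omega) py w2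
    obtain rfl := f _ _ _ _ le_rfl py1 q
    obtain rfl := f _ _ _ _ le_rfl py2 q'
    obtain ⟨z, z1, z2⟩ := key k y (by omega) py ey1 ey2
    rw [g] at z1; rw [g'] at z2
    exact (Option.some.inj z1).trans (Option.some.inj z2).symm
  have hr1 := fun i hi => (a n u r le_rfl q i hi).1
  have hr2 := fun i hi => (a n u' r' le_rfl q' i hi).1
  have ci := A.col e
  have cj := A.col e'
  have s1 := A.hstep e
  have s2 := A.hstep e'
  rcases col_trichotomy i j with rfl | hij | hij
  · obtain rfl := A.inj e e'
    obtain rfl := f _ _ _ _ le_rfl q q'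
    rw [g] at g'
    exact Option.some.inj g'
  · have hji := neighb_symm hij
    have n1 := A.near e cj hij
    have n2 := A.near e' ci hji
    by_cases l1 : h j v = h j u + 1
    · obtain ⟨l2, w, w1, w2⟩ := A.square_dual e e' hij l1
      refine square_case w w1 w2 fun k y hk py y1 y2 => ?_
      have hw := fun i hi => (a k w y hk py i hi).1
      have s3 := A.hstep w2
      have := hw i ci
      have := hr1 i ci
      obtain ⟨-, z, z1, z2⟩ := B.square y1 y2 hji (by omega)
      exact ⟨z, z1, z2⟩
    by_cases l2 : h i v = h i u' + 1
    · obtain ⟨l2, w, w1, w2⟩ := A.square_dual e' e hji l2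
      refine square_case w w2 w1 fun k y hk py y1 y2 => ?_
      have hw := fun i hi => (a k w y hk py i hi).1
      have s3 := A.hstep w2
      have := hw j cj
      have := hr2 j cj
      obtain ⟨-, z, z1, z2⟩ := B.square y2 y1 hij (by omega)
      exact ⟨z, z2, z1⟩
    have l1' : h j v = h j u := by omega
    have l2' : h i v = h i u' := by omega
    obtain ⟨w, x₁, x₂, y₁, y₂, e₁, e₂, e₃, f₁, f₂, f₃⟩ := A.verma_dual e e' hij l1' l2'
    have b1 := A.verma_label hij e e' l1' l2' e₁ e₂ e₃ f₁ f₂ f₃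
    have b2 := A.verma_label hji e' e l2' l1' f₁ f₂ f₃ e₁ e₂ e₃
    obtain ⟨_, rfl, r₂⟩ := A.reach_pred hr q.reach e₃
    obtain ⟨_, rfl, r₁⟩ := A.reach_pred hr r₂ e₂
    obtain ⟨k, rfl, rk⟩ := A.reach_pred hr r₁ e₁
    obtain ⟨y, py⟩ := a.exists_paired A B rk (by omega)
    obtain ⟨m1, em1, pm1⟩ := a.lift A B (by omega) py e₁
    obtain ⟨m2, em2, pm2⟩ := a.lift A B (by omega) pm1 e₂
    obtain ⟨m3, em3, pm3⟩ := a.lift A B (by omega) pm2 e₃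
    obtain ⟨o1, eo1, po1⟩ := a.lift A B (by omega) py f₁
    obtain ⟨o2, eo2, po2⟩ := a.lift A B (by omega) po1 f₂
    obtain ⟨o3, eo3, po3⟩ := a.lift A B (by omega) po2 f₃
    obtain rfl := f _ _ _ _ le_rfl pm3 q
    obtain rfl := f _ _ _ _ le_rfl po3 q'
    have c1 := (a _ _ _ (by omega) py j cj).1
    have c2 := (a _ _ _ (by omega) py i ci).1
    have c3 := (a _ _ _ (by omega) pm1 j cj).1
    have c4 := (a _ _ _ (by omega) po1 i ci).1
    obtain ⟨z2, z3, z2', z3', z, d1, d2, d3, d4, d5, d6⟩ :=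
      B.verma em1 eo1 hij (by omega) (by omega)
    rw [em2] at d1; obtain rfl := Option.some.inj d1
    rw [em3] at d2; obtain rfl := Option.some.inj d2
    rw [eo2] at d4; obtain rfl := Option.some.inj d4
    rw [eo3] at d5; obtain rfl := Option.some.inj d5
    rw [g] at d3; rw [g'] at d6
    exact (Option.some.inj d3).trans (Option.some.inj d6).symm
  · obtain ⟨w, w1, w2⟩ := A.commute_dual e e' hij
    refine square_case w w1 w2 fun k y hk py y1 y2 => ?_
    obtain ⟨z, z1, z2⟩ := B.commute y2 y1 hij
    exact ⟨z, z2, z1⟩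

/-- If `v` has an incoming `j`-edge, its string lengths of color `j` agree with those of any
vertex paired with it. -/
lemma agree_of_pred (A : Axioms G h t) (B : Axioms H h' t')
    (hr : ∀ v, ∃ n, Reach G s n v) {n : ℕ}
    (a : Agree G H s s' h t h' t' n) (f : Functional G H s s' (n + 1)) {v u : G.V} {m : H.V}
    (p : Paired G H s s' (n + 1) v m) {j : ℕ} (e : G.F j u = some v) :
    h j v = h' j m ∧ t j v = t' j m := by
  obtain ⟨k, hk, rk⟩ := A.reach_pred hr p.reach e
  obtain rfl : n = k := by omega
  obtain ⟨y, py⟩ := a.exists_paired A B rk (by omega)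
  obtain ⟨y', ey, py'⟩ := a.lift A B (by omega) py e
  obtain rfl := f _ _ _ _ le_rfl py' p
  have := a _ _ _ le_rfl py j (A.col e)
  have := A.hstep e
  have := A.tstep e
  have := B.hstep ey
  have := B.tstep ey
  omega

lemma agree_succ (A : Axioms G h t) (B : Axioms H h' t')
    (hr : ∀ v, ∃ n, Reach G s n v) (hr' : ∀ v, ∃ n, Reach H s' n v) {n : ℕ}
    (a : Agree G H s s' h t h' t' n) (f : Functional G H s s' (n + 1))
    (f' : Functional H G s' s (n + 1)) : Agree G H s s' h t h' t' (n + 1) := by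
  intro k v m hk p j hj
  rcases Nat.lt_or_ge n k with hk' | hk'
  swap
  · exact a k v m hk' p j hj
  obtain rfl : k = n + 1 := by omega
  by_cases ht : 0 < t j v
  · obtain ⟨u, e⟩ := A.tpos hj ht
    exact agree_of_pred A B hr a f p e
  by_cases ht' : 0 < t' j m
  · obtain ⟨u, e⟩ := B.tpos hj ht'
    have := agree_of_pred B A hr' a.symm f' p.symm e
    exact ⟨this.1.symm, this.2.symm⟩
  have a1 := A.tnn (u := v) hj
  have a2 := B.tnn (u := m) hj
  cases p with
  | step i q e g =>
  have b := a _ _ _ le_rfl q j hj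
  rcases col_trichotomy i j with rfl | hij | hij
  · have := A.tstep e
    have := A.hstep e
    have := B.hstep g
    have := B.tstep g
    omega
  · have := A.near e hj hij
    have := B.near g hj hij
    omega
  · have := A.far e hj hij
    have := B.far g hj hij
    omega

lemma agree_and_functional (A : Axioms G h t) (B : Axioms H h' t')
    (hr : ∀ v, ∃ n, Reach G s n v) (hr' : ∀ v, ∃ n, Reach H s' n v)
    (h0 : ∀ i, Col i → h i s = h' i s' ∧ t i s = t' i s') (n : ℕ) :
    Agree G H s s' h t h' t' n ∧ Functional G H s s' n ∧ Functional H G s' s n := by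
  induction n with
  | zero =>
    refine ⟨?_, ?_, ?_⟩
    · intro k u m hk p
      obtain rfl : k = 0 := by omega
      cases p; exact h0
    all_goals
      intro k u m m' hk p p'
      obtain rfl : k = 0 := by omega
      cases p; cases p'; rfl
  | succ n ih =>
    obtain ⟨a, f, f'⟩ := ih
    have g : Functional G H s s' (n + 1) := by
      intro k u m m' hk p p'
      rcases Nat.lt_or_ge n k with hk' | hk'
      · obtain rfl : k = n + 1 := by omega
        exact functional_succ A B hr a f p p'
      · exact f k u m m' hk' p p'
    have g' : Functional H G s' s (n + 1) := by
      intro k u m m' hk p p'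
      rcases Nat.lt_or_ge n k with hk' | hk'
      · obtain rfl : k = n + 1 := by omega
        exact functional_succ B A hr' a.symm f' p p'
      · exact f' k u m m' hk' p p'
    exact ⟨agree_succ A B hr hr' a g g', g, g'⟩

/-- Two crystals whose sources have the same string lengths are isomorphic. -/
lemma exists_iso (A : Axioms G h t) (B : Axioms H h' t')
    (hr : ∀ v, ∃ n, Reach G s n v) (hr' : ∀ v, ∃ n, Reach H s' n v)
    (h0 : ∀ i, Col i → h i s = h' i s' ∧ t i s = t' i s') :
    ∃ φ : G.V ≃ H.V, φ s = s' ∧ ∀ i u v, G.F i u = some v ↔ H.F i (φ u) = some (φ v) := by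
  have key := agree_and_functional A B hr hr' h0
  have ex : ∀ u, ∃ m n, Paired G H s s' n u m := by
    intro u
    obtain ⟨n, r⟩ := hr u
    obtain ⟨m, p⟩ := (key n).1.exists_paired A B r (by omega)
    exact ⟨m, n, p⟩
  have ex' : ∀ m, ∃ u n, Paired G H s s' n u m := by
    intro m
    obtain ⟨n, r⟩ := hr' m
    obtain ⟨u, p⟩ := (key n).1.symm.exists_paired B A r (by omega)
    exact ⟨u, n, p.symm⟩
  have fn : ∀ {u m m' n k}, Paired G H s s' n u m → Paired G H s s' k u m' → m = m' := by
    intro u m m' n k p p'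
    obtain rfl := A.reach_unique p.reach p'.reach
    exact (key n).2.1 _ _ _ _ le_rfl p p'
  have fn' : ∀ {u u' m n k}, Paired G H s s' n u m → Paired G H s s' k u' m → u = u' := by
    intro u u' m n k p p'
    obtain rfl := B.reach_unique p.symm.reach p'.symm.reach
    exact (key n).2.2 _ _ _ _ le_rfl p.symm p'.symm
  choose φ d hφ using ex
  choose ψ d' hψ using ex'
  refine ⟨⟨φ, ψ, fun u => fn' (hψ _) (hφ u), fun m => fn (hφ _) (hψ m)⟩,
    fn (hφ s) .base, fun i u v => ⟨fun e => ?_, fun e => ?_⟩⟩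
  · obtain ⟨m', em, pm⟩ := (key (d u)).1.lift A B le_rfl (hφ u) e
    obtain rfl := fn pm (hφ v)
    exact em
  · obtain ⟨v', ev, pv⟩ := (key (d u)).1.symm.lift B A le_rfl (hφ u).symm e
    obtain rfl := fn' pv.symm (hφ v)
    exact ev

end Uniqueness
/-! ### String lengths in colored graphs -/

lemma optIter_add {V : Type} (f : V → Option V) (k l : ℕ) (v : V) :
    optIter f (k + l) v = (optIter f k v).bind (optIter f l) := by
  induction k generalizing v with
  | zero => simp [optIter]
  | succ k ih =>
    rw [Nat.succ_add]
    simp only [optIter, Option.bind_assoc]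
    congr 1
    funext w
    exact ih w

lemma optIter_one {V : Type} (f : V → Option V) (v : V) : optIter f 1 v = f v := by
  simp [optIter]

lemma Nat.le_sSup_iff_of_lower {S : Set ℕ} (hS : S.Finite) (h0 : 0 ∈ S)
    (hl : ∀ k, k + 1 ∈ S → k ∈ S) (k : ℕ) : k ≤ sSup S ↔ k ∈ S := by
  constructor
  · intro hk
    have hm := Nat.sSup_mem ⟨0, h0⟩ hS.bddAbove
    exact Nat.decreasingInduction (motive := fun m _ => m ∈ S) (fun m _ => hl m) hm hk
  · exact fun hk => le_csSup hS.bddAbove hk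

section Strings

variable {K : PreGraph} {C : Set ℕ}

lemma IsColored.le_h_iff (hK : IsColored K C) (i : ℕ) (v : K.V) (k : ℕ) :
    k ≤ K.h i v ↔ (optIter (K.F i) k v).isSome = true := by
  obtain ⟨hf, -, -, hc⟩ := hK
  refine Nat.le_sSup_iff_of_lower (S := {k | (optIter (K.F i) k v).isSome = true}) ?_ ?_ ?_ k
  · refine Set.Finite.of_injOn (f := fun k => optIter (K.F i) k v) (t := Set.univ)
      (fun _ _ => Set.mem_univ _) ?_ (Set.toFinite _)
    have key : ∀ k l, (optIter (K.F i) k v).isSome = true → k < l →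
        optIter (K.F i) k v ≠ optIter (K.F i) l v := by
      intro k l hk hkl heq
      obtain ⟨w, hw⟩ := Option.isSome_iff_exists.1 hk
      obtain ⟨d, rfl⟩ := Nat.exists_eq_add_of_lt hkl
      rw [add_assoc, optIter_add, hw] at heq
      exact hc i w (d + 1) (by omega) heq.symm
    intro k hk l hl heq
    rcases lt_trichotomy k l with h | h | h
    · exact absurd heq (key k l hk h)
    · exact h
    · exact absurd heq.symm (key l k hl h)
  · simp [optIter]
  · intro k hk
    simp only [Set.mem_ofPred_eq, optIter_add (K.F i) k 1] at hk ⊢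
    cases h : optIter (K.F i) k v <;> simp_all

lemma IsColored.le_t_iff (hK : IsColored K C) (i : ℕ) (v : K.V) (k : ℕ) :
    k ≤ K.t i v ↔ ∃ u, optIter (K.F i) k u = some v := by
  obtain ⟨hf, -, -, hc⟩ := hK
  refine Nat.le_sSup_iff_of_lower (S := {k | ∃ u, optIter (K.F i) k u = some v}) ?_ ?_ ?_ k
  · have key : ∀ k l u, k < l → optIter (K.F i) k u = some v →
        optIter (K.F i) l u ≠ some v := by
      intro k l u hkl hk hl
      obtain ⟨d, rfl⟩ := Nat.exists_eq_add_of_lt hkl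
      rw [add_assoc, optIter_add, hk] at hl
      exact hc i v (d + 1) (by omega) hl
    refine Set.Finite.of_injOn (t := Set.univ)
      (f := fun k => if h : ∃ u, optIter (K.F i) k u = some v then h.choose else v)
      (fun _ _ => Set.mem_univ _) ?_ (Set.toFinite _)
    intro k hk l hl heq
    simp only [Set.mem_ofPred_eq] at hk hl
    simp only [hk, hl, dif_pos] at heq
    have e1 := hk.choose_spec
    have e2 := hl.choose_spec
    rw [← heq] at e2
    rcases lt_trichotomy k l with h | h | h
    · exact absurd e2 (key _ _ _ h e1)
    · exact h
    · exact absurd e1 (key _ _ _ h e2)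
  · exact ⟨v, rfl⟩
  · rintro k ⟨u, hu⟩
    simp only [optIter, Option.bind_eq_some_iff] at hu
    obtain ⟨w, -, hw⟩ := hu
    exact ⟨w, hw⟩

lemma IsColored.h_step (hK : IsColored K C) {i : ℕ} {u v : K.V} (e : K.F i u = some v) :
    K.h i u = K.h i v + 1 := by
  have key : ∀ k, k + 1 ≤ K.h i u ↔ k ≤ K.h i v := by
    intro k
    rw [hK.le_h_iff, hK.le_h_iff]
    simp [optIter, e]
  have := (key (K.h i v)).2 le_rfl
  have := (key (K.h i u - 1)).1 (by omega)
  omega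

lemma IsColored.t_step (hK : IsColored K C) {i : ℕ} {u v : K.V} (e : K.F i u = some v) :
    K.t i v = K.t i u + 1 := by
  have key : ∀ k, k + 1 ≤ K.t i v ↔ k ≤ K.t i u := by
    intro k
    rw [hK.le_t_iff, hK.le_t_iff]
    refine exists_congr fun w => ?_
    rw [optIter_add (K.F i) k 1, Option.bind_eq_some_iff]
    simp only [optIter_one]
    constructor
    · rintro ⟨x, hx, hxv⟩
      rw [hx, hK.2.2.1 i _ _ _ hxv e]
    · exact fun hw => ⟨u, hw, e⟩
  have := (key (K.t i u)).2 le_rfl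
  have := (key (K.t i v - 1)).1 (by omega)
  omega

lemma IsColored.exists_of_h_pos (hK : IsColored K C) {i : ℕ} {u : K.V} (hu : 0 < K.h i u) :
    ∃ v, K.F i u = some v := by
  have := (hK.le_h_iff i u 1).1 hu
  rw [optIter_one] at this
  exact Option.isSome_iff_exists.1 this

lemma IsColored.exists_of_t_pos (hK : IsColored K C) {i : ℕ} {v : K.V} (hv : 0 < K.t i v) :
    ∃ u, K.F i u = some v := by
  have := (hK.le_t_iff i v 1).1 hv
  simpa only [optIter_one] using this

lemma IsColored.finv_eq_some_iff (hK : IsColored K C) {i : ℕ} {u v : K.V} :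
    K.Finv i v = some u ↔ K.F i u = some v := by
  unfold PreGraph.Finv
  constructor
  · intro h
    split_ifs at h with hex
    rw [← Option.some.inj h]
    exact hex.choose_spec
  · intro h
    have hex : ∃ u, K.F i u = some v := ⟨u, h⟩
    rw [dif_pos hex, hK.2.2.1 i _ _ _ hex.choose_spec h]

end Strings

lemma IsACrystal.regular {K : PreGraph} (hK : IsACrystal 3 K) :
    Axioms K (fun i v => (K.h i v : ℤ)) (fun i v => (K.t i v : ℤ)) := by
  obtain ⟨hcol, -, hA2, hA34, hA5⟩ := hK
  have col : ∀ {i u v}, K.F i u = some v → Col i := by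
    intro i u v e
    by_contra hi
    have := hcol.2.1 i hi u
    simp [this] at e
  have ne : ∀ {i j}, Neighb i j → i ≠ j := by
    intro i j h; unfold Neighb at h; omega
  have far_ne : ∀ {i j}, Far i j → i ≠ j ∧ ¬ Neighb i j := by
    intro i j h; unfold Neighb; unfold Far at h; omega
  refine ⟨col, fun e e' => hcol.2.2.1 _ _ _ _ e e', ?_, ?_, ?_, ?_, ?_, ?_, ?_, ?_, ?_, ?_, ?_,
    ?_, ?_, ?_⟩
  · intro i u _ h
    exact hcol.exists_of_h_pos (by exact_mod_cast h)
  · intro i u _ h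
    exact hcol.exists_of_t_pos (by exact_mod_cast h)
  · intros; positivity
  · intros; positivity
  · intro i u v e
    have := hcol.h_step e
    omega
  · intro i u v e
    have := hcol.t_step e
    omega
  · intro i j u v e hj hij
    have := (hA2 i (col e) j hj (ne hij)).1 u v e
    rw [if_pos hij] at this
    omega
  · intro i j u v e hj hij
    have := (hA2 i (col e) j hj (far_ne hij).1).1 u v e
    rw [if_neg (far_ne hij).2] at this
    omega
  · intro i j u v v' e e' hij hl
    obtain ⟨h1, h2⟩ := (hA34 i (col e) j (col e') hij).1.1 u v v' e e' (by exact_mod_cast hl)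
    exact ⟨by omega, h2⟩
  · intro i j u u' v e e' hij hl
    obtain ⟨h1, h2⟩ := (hA34 i (col e) j (col e') hij).1.2 u u' v e e' (by omega)
    exact ⟨by exact_mod_cast h1, h2⟩
  · intro i j u v v' e e' hij hl hl'
    obtain ⟨w, h1, h2⟩ := (hA34 i (col e) j (col e') hij).2.1 u v v' e e' (by omega) (by omega)
    simp only [e, e', Option.bind_some, Option.bind_eq_some_iff] at h1 h2
    obtain ⟨x3, ⟨x2, h11, h12⟩, h13⟩ := h1
    obtain ⟨y3, ⟨y2, h21, h22⟩, h23⟩ := h2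
    exact ⟨x2, x3, y2, y3, w, h11, h12, h13, h21, h22, h23⟩
  · intro i j u u' v e e' hij hl hl'
    obtain ⟨w, h1, h2⟩ := (hA34 i (col e) j (col e') hij).2.2 u u' v e e'
      (by exact_mod_cast hl) (by exact_mod_cast hl')
    simp only [hcol.finv_eq_some_iff.2 e, hcol.finv_eq_some_iff.2 e', Option.bind_some,
      Option.bind_eq_some_iff, hcol.finv_eq_some_iff] at h1 h2
    obtain ⟨x1, ⟨x2, h11, h12⟩, h13⟩ := h1
    obtain ⟨y1, ⟨y2, h21, h22⟩, h23⟩ := h2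
    exact ⟨w, x1, x2, y1, y2, h13, h12, h11, h23, h22, h21⟩
  · intro i j u v v' e e' hij
    obtain ⟨w, h1, h2⟩ := hA5 i (col e) j (col e') hij (K.F i) (by simp) (K.F j) (by simp) u
      (by simp [e]) (by simp [e'])
    rw [e] at h1; rw [e'] at h2
    exact ⟨w, h1, h2⟩
  · intro i j u u' v e e' hij
    have f := hcol.finv_eq_some_iff.2 e
    have f' := hcol.finv_eq_some_iff.2 e'
    obtain ⟨w, h1, h2⟩ := hA5 i (col e) j (col e') hij (K.Finv i) (by simp) (K.Finv j) (by simp) v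
      (by simp [f]) (by simp [f'])
    rw [f] at h1; rw [f'] at h2
    exact ⟨w, hcol.finv_eq_some_iff.1 h1, hcol.finv_eq_some_iff.1 h2⟩

section Source

variable {G : PreGraph} {h t : ℕ → G.V → ℤ}

lemma dirReach.exists_reach {s v : G.V} (r : dirReach G s v) : ∃ n, Reach G s n v := by
  induction r with
  | refl => exact ⟨0, .base⟩
  | tail _ e ih =>
    obtain ⟨n, r⟩ := ih
    obtain ⟨i, e⟩ := e
    exact ⟨n + 1, .step i r e⟩

/-- Two predecessors of a vertex have a common ancestor. -/
lemma Axioms.common_ancestor (A : Axioms G h t) {i j : ℕ} {u u' v : G.V}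
    (e : G.F i u = some v) (e' : G.F j u' = some v) :
    ∃ w, dirReach G w u ∧ dirReach G w u' := by
  have near_one : ∀ {i j : ℕ} {u u' v : G.V}, G.F i u = some v → G.F j u' = some v →
      Neighb i j → h j v = h j u ∨ h j v = h j u + 1 := by
    intro i j u u' v e e' hij
    have := A.near e (A.col e') hij
    omega
  have one : ∀ {w x : G.V} {k : ℕ}, G.F k w = some x → dirReach G w x :=
    fun e => .single ⟨_, e⟩
  rcases col_trichotomy i j with rfl | hij | hij
  · obtain rfl := A.inj e e'
    exact ⟨u, .refl, .refl⟩
  · have hji := neighb_symm hij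
    rcases near_one e e' hij with l1 | l1
    · rcases near_one e' e hji with l2 | l2
      · obtain ⟨w, x₁, x₂, y₁, y₂, e₁, e₂, e₃, f₁, f₂, f₃⟩ := A.verma_dual e e' hij l1 l2
        exact ⟨w, (one e₁).trans ((one e₂).trans (one e₃)),
          (one f₁).trans ((one f₂).trans (one f₃))⟩
      · obtain ⟨-, w, w1, w2⟩ := A.square_dual e' e hji l2
        exact ⟨w, one w2, one w1⟩
    · obtain ⟨-, w, w1, w2⟩ := A.square_dual e e' hij l1
      exact ⟨w, one w1, one w2⟩
  · obtain ⟨w, w1, w2⟩ := A.commute_dual e e' hij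
    exact ⟨w, one w1, one w2⟩

/-- Every vertex is reachable from exactly one source. -/
lemma Axioms.exists_unique_source (A : Axioms G h t) [Finite G.V] (v : G.V) :
    ∃! s, IsSource G s ∧ dirReach G s v := by
  obtain ⟨B, hB⟩ := (Set.finite_range (height h t)).bddAbove
  have hB : ∀ v, height h t v ≤ B := fun v => hB ⟨v, rfl⟩
  obtain ⟨n, hn⟩ : ∃ n : ℕ, (B - height h t v).toNat = n := ⟨_, rfl⟩
  induction n using Nat.strong_induction_on generalizing v with
  | _ n ih =>
  have ih' : ∀ i u, G.F i u = some v → ∃! s, IsSource G s ∧ dirReach G s u := by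
    intro i u e
    have := A.height_step e
    have := hB u
    exact ih _ (by omega) u rfl
  by_cases hv : IsSource G v
  · refine ⟨v, ⟨hv, .refl⟩, ?_⟩
    rintro s ⟨-, r⟩
    rcases Relation.ReflTransGen.cases_tail r with rfl | ⟨u, -, i, e⟩
    · rfl
    · exact absurd e (hv i u)
  · simp only [IsSource, not_forall, not_not] at hv
    obtain ⟨i, u, e⟩ := hv
    obtain ⟨s, ⟨hs, hsu⟩, hu⟩ := ih' i u e
    refine ⟨s, ⟨hs, hsu.tail ⟨i, e⟩⟩, ?_⟩
    rintro s' ⟨hs', r⟩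
    rcases Relation.ReflTransGen.cases_tail r with rfl | ⟨u', r', j, e'⟩
    · exact absurd e (hs' i u)
    obtain ⟨w, w1, w2⟩ := A.common_ancestor e e'
    have key : ∃ x, IsSource G x ∧ dirReach G x w := by
      have hw : height h t u ≤ height h t w := by
        obtain ⟨m, hm⟩ := w1.exists_reach
        have := A.height_reach hm
        omega
      have := A.height_step e
      have := hB w
      have := hB u
      exact (ih _ (by omega) w rfl).exists
    obtain ⟨x, hx, hxw⟩ := key
    rw [← hu x ⟨hx, hxw.trans w1⟩]
    exact (ih' j u' e').unique ⟨hs', r'⟩ ⟨hx, hxw.trans w2⟩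

/-- In a connected crystal every vertex is reachable from any source. -/
lemma Axioms.reach_of_isSource (A : Axioms G h t) [Finite G.V] (hG : G.Connected) {s : G.V}
    (hs : IsSource G s) (v : G.V) : ∃ n, Reach G s n v := by
  suffices dirReach G s v from this.exists_reach
  induction hG s v with
  | refl => exact .refl
  | tail _ e ih =>
    obtain ⟨i, e | e⟩ := e
    · exact ih.tail ⟨i, e⟩
    · rename_i b c _
      obtain ⟨x, hx, hxc⟩ := (A.exists_unique_source c).exists
      rwa [(A.exists_unique_source b).unique ⟨hs, ih⟩ ⟨hx, hxc.tail ⟨i, e⟩⟩]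

end Source
/-! ### An explicit model of the symmetric crystal `K(c₁, c₂, c₁)` -/

/-- Coordinates of a vertex: the upper subcrystal `K^up[a]` containing it, the deviation `d` of
its middle subcrystal in `Π^up[a]`, and its position `l` in the middle subcrystal. -/
@[ext]
structure Coord where
  a₁ : ℤ
  a₂ : ℤ
  a₃ : ℤ
  d₁ : ℤ
  d₂ : ℤ
  l : ℤ

namespace Coord

/-- The coordinates occurring in `K(c₁, c₂, c₁)`. -/
def Valid (c₁ c₂ : ℤ) (x : Coord) : Prop :=
  (0 ≤ x.a₁ ∧ x.a₁ ≤ c₁) ∧ (0 ≤ x.a₂ ∧ x.a₂ ≤ c₂) ∧ (0 ≤ x.a₃ ∧ x.a₃ ≤ c₁) ∧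
  (-x.a₂ ≤ x.d₁ ∧ x.d₁ ≤ c₁ - x.a₁) ∧ (-x.a₃ ≤ x.d₂ ∧ x.d₂ ≤ c₂ - x.a₂) ∧
  (0 ≤ x.l ∧ x.l ≤ c₂ - x.d₂ + x.d₁)

/-- The involution exchanging upper and lower subcrystals. -/
def mirror (x : Coord) : Coord :=
  ⟨x.a₃ + min x.d₂ 0, x.a₂ + min x.d₁ 0 + max x.d₂ 0, x.a₁ + max x.d₁ 0, -x.d₂, -x.d₁, x.l⟩

lemma mirror_mirror (x : Coord) : x.mirror.mirror = x := by
  ext <;> simp only [mirror] <;> omega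

lemma Valid.mirror {c₁ c₂ : ℤ} {x : Coord} (hx : x.Valid c₁ c₂) : x.mirror.Valid c₁ c₂ := by
  simp only [Valid, Coord.mirror] at *
  omega

/-- The move of color `1`. -/
def move₁ (x : Coord) : Coord :=
  if x.a₂ + x.d₁ < x.l then { x with d₂ := x.d₂ + 1, l := x.l - 1 }
  else { x with d₁ := x.d₁ + 1 }

/-- The move of color `2`. -/
def move₂ (x : Coord) : Coord := { x with l := x.l + 1 }

/-- The move of color `i`. -/
def move (i : ℕ) (x : Coord) : Coord :=
  if i = 1 then x.move₁ else if i = 2 then x.move₂ else x.mirror.move₁.mirror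

/-- The number of edges of a path from the source to `x`. -/
def depth (x : Coord) : ℤ := 3 * (x.a₁ + x.a₂ + x.a₃) + x.d₁ + 2 * x.d₂ + x.l

/-- `y` is obtained from `x` by the move of color `1`. -/
def Edge₁ (x y : Coord) : Prop :=
  y.a₁ = x.a₁ ∧ y.a₂ = x.a₂ ∧ y.a₃ = x.a₃ ∧
  ((x.a₂ + x.d₁ < x.l ∧ y.d₁ = x.d₁ ∧ y.d₂ = x.d₂ + 1 ∧ y.l = x.l - 1) ∨
   (x.l ≤ x.a₂ + x.d₁ ∧ y.d₁ = x.d₁ + 1 ∧ y.d₂ = x.d₂ ∧ y.l = x.l))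

/-- `y` is obtained from `x` by the move of color `2`. -/
def Edge₂ (x y : Coord) : Prop :=
  y.a₁ = x.a₁ ∧ y.a₂ = x.a₂ ∧ y.a₃ = x.a₃ ∧ y.d₁ = x.d₁ ∧ y.d₂ = x.d₂ ∧ y.l = x.l + 1

/-- `y` is obtained from `x` by the move of color `3`. -/
def Edge₃ (x y : Coord) : Prop :=
  (x.a₂ + min x.d₁ 0 - min x.d₂ 0 < x.l ∧ y.d₁ = x.d₁ - 1 ∧ y.d₂ = x.d₂ ∧ y.l = x.l - 1 ∧
    y.a₃ = x.a₃ ∧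
    ((0 < x.d₁ ∧ y.a₁ = x.a₁ + 1 ∧ y.a₂ = x.a₂) ∨
     (x.d₁ ≤ 0 ∧ y.a₁ = x.a₁ ∧ y.a₂ = x.a₂ + 1))) ∨
  (x.l ≤ x.a₂ + min x.d₁ 0 - min x.d₂ 0 ∧ y.d₁ = x.d₁ ∧ y.d₂ = x.d₂ - 1 ∧ y.l = x.l ∧
    y.a₁ = x.a₁ ∧
    ((0 < x.d₂ ∧ y.a₂ = x.a₂ + 1 ∧ y.a₃ = x.a₃) ∨
     (x.d₂ ≤ 0 ∧ y.a₂ = x.a₂ ∧ y.a₃ = x.a₃ + 1)))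

lemma eq_move₁_iff {x y : Coord} : y = x.move₁ ↔ Edge₁ x y := by
  simp only [Coord.ext_iff, move₁, Edge₁]
  split_ifs <;> simp only <;> omega

lemma eq_move₂_iff {x y : Coord} : y = x.move₂ ↔ Edge₂ x y := by
  simp only [Coord.ext_iff, move₂, Edge₂]

lemma eq_move₃_iff {x y : Coord} : y = x.mirror.move₁.mirror ↔ Edge₃ x y := by
  simp only [Coord.ext_iff, move₁, Edge₃]
  split_ifs <;> simp only [mirror] at * <;> omega

end Coord

open Coord

/-- The model of `K(c₁, c₂, c₁)` on coordinates. -/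
noncomputable def Model (c₁ c₂ : ℤ) : PreGraph where
  V := {x : Coord // x.Valid c₁ c₂}
  F := fun i x =>
    if hy : Col i ∧ (x.1.move i).Valid c₁ c₂ then some ⟨x.1.move i, hy.2⟩ else none

namespace Model

variable {c₁ c₂ : ℤ}

/-- The involution of the model exchanging the colors `1` and `3`. -/
def inv (x : (Model c₁ c₂).V) : (Model c₁ c₂).V := ⟨x.1.mirror, x.2.mirror⟩

lemma inv_inv (x : (Model c₁ c₂).V) : inv (inv x) = x := Subtype.ext (mirror_mirror x.1)

/-- Lengths of the strings beginning at a vertex. -/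
def h (i : ℕ) (x : (Model c₁ c₂).V) : ℤ :=
  if i = 1 then max (x.1.l - x.1.a₂ - x.1.d₁) 0 + c₁ - x.1.a₁ - x.1.d₁
  else if i = 2 then c₂ - x.1.d₂ + x.1.d₁ - x.1.l
  else max (x.1.l - x.1.a₂ - min x.1.d₁ 0 + min x.1.d₂ 0) 0 + c₁ - x.1.a₃ + max x.1.d₂ 0

/-- Lengths of the strings ending at a vertex. -/
def t (i : ℕ) (x : (Model c₁ c₂).V) : ℤ :=
  if i = 1 then max (x.1.a₂ + x.1.d₁ - x.1.l) 0 + x.1.a₃ + x.1.d₂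
  else if i = 2 then x.1.l
  else max (x.1.a₂ + min x.1.d₁ 0 - min x.1.d₂ 0 - x.1.l) 0 + x.1.a₁ - min x.1.d₁ 0

lemma edge_iff {i : ℕ} {x y : (Model c₁ c₂).V} :
    (Model c₁ c₂).F i x = some y ↔ Col i ∧ y.1 = x.1.move i := by
  obtain ⟨y, hy⟩ := y
  simp only [Model]
  by_cases hv : Col i ∧ (x.1.move i).Valid c₁ c₂
  · rw [dif_pos hv]
    simp [hv.1, eq_comm]
  · rw [dif_neg hv]
    simp only [reduceCtorEq, false_iff]
    rintro ⟨hi, rfl⟩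
    exact hv ⟨hi, hy⟩

lemma col {i : ℕ} {x y : (Model c₁ c₂).V} (e : (Model c₁ c₂).F i x = some y) : Col i :=
  (edge_iff.1 e).1

lemma edge₁ {x y : (Model c₁ c₂).V} : (Model c₁ c₂).F 1 x = some y ↔ Edge₁ x.1 y.1 := by
  rw [edge_iff, ← eq_move₁_iff]
  simp [Col, move]

lemma edge₂ {x y : (Model c₁ c₂).V} : (Model c₁ c₂).F 2 x = some y ↔ Edge₂ x.1 y.1 := by
  rw [edge_iff, ← eq_move₂_iff]
  simp [Col, move]

lemma edge₃ {x y : (Model c₁ c₂).V} : (Model c₁ c₂).F 3 x = some y ↔ Edge₃ x.1 y.1 := by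
  rw [edge_iff, ← eq_move₃_iff]
  simp [Col, move]

lemma edge_inv_of_edge {i : ℕ} {x y : (Model c₁ c₂).V} (e : (Model c₁ c₂).F i x = some y) :
    (Model c₁ c₂).F (4 - i) (inv x) = some (inv y) := by
  have hi : i = 1 ∨ i = 2 ∨ i = 3 := by
    have := col e
    unfold Col at this
    omega
  rcases hi with rfl | rfl | rfl
  · rw [edge₁, ← eq_move₁_iff] at e
    rw [edge₃, ← eq_move₃_iff]
    simp only [inv, mirror_mirror, e]
  · rw [edge₂, ← eq_move₂_iff] at e
    rw [edge₂, ← eq_move₂_iff]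
    simp [inv, e, move₂, Coord.mirror]
  · rw [edge₃, ← eq_move₃_iff] at e
    rw [edge₁, ← eq_move₁_iff]
    simp only [inv, mirror_mirror, e]

lemma h_inv {i : ℕ} (hi : Col i) (x : (Model c₁ c₂).V) : h (4 - i) (inv x) = h i x := by
  have hi : i = 1 ∨ i = 2 ∨ i = 3 := by unfold Col at hi; omega
  rcases hi with rfl | rfl | rfl <;> simp [h, inv, Coord.mirror] <;> omega

lemma t_inv {i : ℕ} (hi : Col i) (x : (Model c₁ c₂).V) : t (4 - i) (inv x) = t i x := by
  have hi : i = 1 ∨ i = 2 ∨ i = 3 := by unfold Col at hi; omega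
  rcases hi with rfl | rfl | rfl <;> simp [t, inv, Coord.mirror] <;> omega

end Model
/-- The axioms relating the neighboring colors `i` and `j`. -/
structure NearAxioms (G : PreGraph) (h t : ℕ → G.V → ℤ) (i j : ℕ) : Prop where
  near : ∀ {u v}, G.F i u = some v →
    h j v - t j v = h j u - t j u + 1 ∧ h j u ≤ h j v ∧ t j v ≤ t j u
  square : ∀ {u v v'}, G.F i u = some v → G.F j u = some v' → h j v = h j u →
    h i v' = h i u + 1 ∧ ∃ w, G.F j v = some w ∧ G.F i v' = some w
  square_dual : ∀ {u u' v}, G.F i u = some v → G.F j u' = some v →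
    h j v = h j u + 1 → h i v = h i u' ∧ ∃ w, G.F j w = some u ∧ G.F i w = some u'
  verma : ∀ {u v v'}, G.F i u = some v → G.F j u = some v' →
    h j v = h j u + 1 → h i v' = h i u + 1 →
    ∃ x₂ x₃ y₂ y₃ w, G.F j v = some x₂ ∧ G.F j x₂ = some x₃ ∧ G.F i x₃ = some w ∧
      G.F i v' = some y₂ ∧ G.F i y₂ = some y₃ ∧ G.F j y₃ = some w
  verma_dual : ∀ {u u' v}, G.F i u = some v → G.F j u' = some v →
    h j v = h j u → h i v = h i u' →
    ∃ w x₁ x₂ y₁ y₂, G.F i w = some x₁ ∧ G.F j x₁ = some x₂ ∧ G.F j x₂ = some u ∧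
      G.F j w = some y₁ ∧ G.F i y₁ = some y₂ ∧ G.F i y₂ = some u'

namespace Model

variable {c₁ c₂ : ℤ}

lemma edge_inv_right {i : ℕ} {x y : (Model c₁ c₂).V}
    (e : (Model c₁ c₂).F i (inv x) = some y) : (Model c₁ c₂).F (4 - i) x = some (inv y) := by
  simpa only [inv_inv] using edge_inv_of_edge e

lemma edge_inv_left {i : ℕ} {x y : (Model c₁ c₂).V}
    (e : (Model c₁ c₂).F i x = some (inv y)) : (Model c₁ c₂).F (4 - i) (inv x) = some y := by
  simpa only [inv_inv] using edge_inv_of_edge e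

lemma nearAxioms_inv {i j : ℕ} (hi : Col i) (hj : Col j)
    (N : NearAxioms (Model c₁ c₂) h t i j) :
    NearAxioms (Model c₁ c₂) h t (4 - i) (4 - j) := by
  have back : ∀ {k x y}, Col k → (Model c₁ c₂).F (4 - k) x = some y →
      (Model c₁ c₂).F k (inv x) = some (inv y) := by
    intro k x y hk e
    have h4 : 4 - (4 - k) = k := by unfold Col at hk; omega
    simpa only [h4] using edge_inv_of_edge e
  have hh : ∀ {k} (x : (Model c₁ c₂).V), Col k → h (4 - k) x = h k (inv x) := by
    intro k x hk
    rw [← h_inv hk, inv_inv]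
  have ht : ∀ {k} (x : (Model c₁ c₂).V), Col k → t (4 - k) x = t k (inv x) := by
    intro k x hk
    rw [← t_inv hk, inv_inv]
  refine ⟨?_, ?_, ?_, ?_, ?_⟩
  · intro u v e
    simp only [hh _ hj, ht _ hj]
    exact N.near (back hi e)
  · intro u v v' e e' hyp
    simp only [hh _ hj, hh _ hi] at hyp ⊢
    obtain ⟨h1, w, e1, e2⟩ := N.square (back hi e) (back hj e') hyp
    exact ⟨h1, inv w, edge_inv_right e1, edge_inv_right e2⟩
  · intro u v v' e e' hyp
    simp only [hh _ hj, hh _ hi] at hyp ⊢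
    obtain ⟨h1, w, e1, e2⟩ := N.square_dual (back hi e) (back hj e') hyp
    exact ⟨h1, inv w, edge_inv_left e1, edge_inv_left e2⟩
  · intro u v v' e e' hyp hyp'
    simp only [hh _ hj, hh _ hi] at hyp hyp'
    obtain ⟨x₂, x₃, y₂, y₃, w, e1, e2, e3, e4, e5, e6⟩ :=
      N.verma (back hi e) (back hj e') hyp hyp'
    exact ⟨inv x₂, inv x₃, inv y₂, inv y₃, inv w, edge_inv_right e1, edge_inv_of_edge e2,
      edge_inv_of_edge e3, edge_inv_right e4, edge_inv_of_edge e5, edge_inv_of_edge e6⟩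
  · intro u v v' e e' hyp hyp'
    simp only [hh _ hj, hh _ hi] at hyp hyp'
    obtain ⟨w, x₁, x₂, y₁, y₂, e1, e2, e3, e4, e5, e6⟩ :=
      N.verma_dual (back hi e) (back hj e') hyp hyp'
    exact ⟨inv w, inv x₁, inv x₂, inv y₁, inv y₂, edge_inv_of_edge e1, edge_inv_of_edge e2,
      edge_inv_left e3, edge_inv_of_edge e4, edge_inv_of_edge e5, edge_inv_left e6⟩

/-- The vertex in the upper subcrystal of `x` with deviation `(d₁, d₂)` and position `l`. -/
def upper (x : Coord) (d₁ d₂ l : ℤ) : Coord := { x with d₁ := d₁, d₂ := d₂, l := l }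

lemma nearAxioms_one_two : NearAxioms (Model c₁ c₂) h t 1 2 := by
  refine ⟨?_, ?_, ?_, ?_, ?_⟩
  · intro u v e
    have hu := u.2
    have hv := v.2
    simp only [edge₁, Edge₁, h, t, Valid, if_true, if_false, OfNat.ofNat_ne_one] at *
    omega
  · intro u v v' e e' hyp
    have hu := u.2
    have hv := v.2
    have hv' := v'.2
    simp only [edge₁, edge₂, Edge₁, Edge₂, h, Valid, if_true, if_false, OfNat.ofNat_ne_one] at *
    refine ⟨by omega, ⟨upper v.1 v.1.d₁ v.1.d₂ (v.1.l + 1), ?_⟩, ?_, ?_⟩ <;>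
      simp only [Valid, upper, and_true] <;> omega
  · intro u v v' e e' hyp
    have hu := u.2
    have hv := v.2
    have hv' := v'.2
    simp only [edge₁, edge₂, Edge₁, Edge₂, h, Valid, if_true, if_false, OfNat.ofNat_ne_one] at *
    refine ⟨by omega, ⟨upper u.1 u.1.d₁ u.1.d₂ (u.1.l - 1), ?_⟩, ?_, ?_⟩ <;>
      simp only [Valid, upper, true_and] <;> omega
  · intro u v v' e e' hyp hyp'
    have hu := u.2
    have hv := v.2
    have hv' := v'.2
    simp only [edge₁, edge₂, Edge₁, Edge₂, h, Valid, if_true, if_false, OfNat.ofNat_ne_one] at *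
    refine ⟨⟨upper u.1 (u.1.d₁ + 1) u.1.d₂ (u.1.l + 1), ?_⟩, ⟨upper u.1 (u.1.d₁ + 1) u.1.d₂ (u.1.l + 2), ?_⟩,
      ⟨upper u.1 u.1.d₁ (u.1.d₂ + 1) u.1.l, ?_⟩, ⟨upper u.1 (u.1.d₁ + 1) (u.1.d₂ + 1) u.1.l, ?_⟩,
      ⟨upper u.1 (u.1.d₁ + 1) (u.1.d₂ + 1) (u.1.l + 1), ?_⟩, ?_⟩ <;>
      simp only [Valid, upper, true_and, and_true] <;> omega
  · intro u u' v e e' hyp hyp'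
    have hu := u.2
    have hu' := u'.2
    have hv := v.2
    simp only [edge₁, edge₂, Edge₁, Edge₂, h, Valid, if_true, if_false, OfNat.ofNat_ne_one] at *
    refine ⟨⟨upper v.1 (v.1.d₁ - 1) (v.1.d₂ - 1) (v.1.l - 1), ?_⟩, ⟨upper v.1 v.1.d₁ (v.1.d₂ - 1) (v.1.l - 1), ?_⟩,
      ⟨upper v.1 v.1.d₁ (v.1.d₂ - 1) v.1.l, ?_⟩, ⟨upper v.1 (v.1.d₁ - 1) (v.1.d₂ - 1) v.1.l, ?_⟩,
      ⟨upper v.1 (v.1.d₁ - 1) v.1.d₂ (v.1.l - 1), ?_⟩, ?_⟩ <;>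
      simp only [Valid, upper, true_and, and_true] <;> omega

lemma nearAxioms_two_one : NearAxioms (Model c₁ c₂) h t 2 1 := by
  refine ⟨?_, ?_, ?_, ?_, ?_⟩
  · intro u v e
    have hu := u.2
    have hv := v.2
    simp only [edge₂, Edge₂, h, t, Valid, if_true] at *
    omega
  · intro u v v' e e' hyp
    have hu := u.2
    have hv := v.2
    have hv' := v'.2
    simp only [edge₁, edge₂, Edge₁, Edge₂, h, Valid, if_true, if_false, OfNat.ofNat_ne_one] at *
    refine ⟨by omega, ⟨upper v'.1 v'.1.d₁ v'.1.d₂ (v'.1.l + 1), ?_⟩, ?_, ?_⟩ <;>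
      simp only [Valid, upper, and_true] <;> omega
  · intro u u' v e e' hyp
    have hu := u.2
    have hu' := u'.2
    have hv := v.2
    simp only [edge₁, edge₂, Edge₁, Edge₂, h, Valid, if_true, if_false, OfNat.ofNat_ne_one] at *
    refine ⟨by omega, ⟨upper u'.1 u'.1.d₁ u'.1.d₂ (u'.1.l - 1), ?_⟩, ?_, ?_⟩ <;>
      simp only [Valid, upper, true_and] <;> omega
  · intro u v v' e e' hyp hyp'
    obtain ⟨x₂, x₃, y₂, y₃, w, e1, e2, e3, e4, e5, e6⟩ := nearAxioms_one_two.verma e' e hyp' hyp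
    exact ⟨y₂, y₃, x₂, x₃, w, e4, e5, e6, e1, e2, e3⟩
  · intro u u' v e e' hyp hyp'
    obtain ⟨w, x₁, x₂, y₁, y₂, e1, e2, e3, e4, e5, e6⟩ :=
      nearAxioms_one_two.verma_dual e' e hyp' hyp
    exact ⟨w, y₁, y₂, x₁, x₂, e4, e5, e6, e1, e2, e3⟩

lemma nearAxioms {i j : ℕ} (hi : Col i) (hj : Col j) (hij : Neighb i j) :
    NearAxioms (Model c₁ c₂) h t i j := by
  have : i = 1 ∧ j = 2 ∨ i = 2 ∧ j = 1 ∨ i = 2 ∧ j = 3 ∨ i = 3 ∧ j = 2 := by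
    unfold Col Neighb at *
    omega
  obtain ⟨rfl, rfl⟩ | ⟨rfl, rfl⟩ | ⟨rfl, rfl⟩ | ⟨rfl, rfl⟩ := this
  · exact nearAxioms_one_two
  · exact nearAxioms_two_one
  · exact nearAxioms_inv (i := 2) (j := 1) (by simp [Col]) (by simp [Col]) nearAxioms_two_one
  · exact nearAxioms_inv (i := 1) (j := 2) (by simp [Col]) (by simp [Col]) nearAxioms_one_two

end Model
/-- The axioms involving only the color `i`. -/
structure ColorAxioms (G : PreGraph) (h t : ℕ → G.V → ℤ) (i : ℕ) : Prop where
  inj : ∀ {u u' v}, G.F i u = some v → G.F i u' = some v → u = u'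
  hpos : ∀ {u}, 0 < h i u → ∃ v, G.F i u = some v
  tpos : ∀ {v}, 0 < t i v → ∃ u, G.F i u = some v
  hnn : ∀ {u}, 0 ≤ h i u
  tnn : ∀ {u}, 0 ≤ t i u
  hstep : ∀ {u v}, G.F i u = some v → h i v = h i u - 1
  tstep : ∀ {u v}, G.F i u = some v → t i v = t i u + 1

namespace Model

variable {c₁ c₂ : ℤ}

lemma colorAxioms_one : ColorAxioms (Model c₁ c₂) h t 1 := by
  refine ⟨?_, ?_, ?_, ?_, ?_, ?_, ?_⟩
  · intro u u' v e e'
    rw [edge₁] at e e'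
    unfold Edge₁ at e e'
    refine Subtype.ext (Coord.ext ?_ ?_ ?_ ?_ ?_ ?_) <;> omega
  · intro u hyp
    have hu := u.2
    simp only [edge₁, Edge₁, h, Valid, if_true] at *
    by_cases hl : u.1.a₂ + u.1.d₁ < u.1.l
    · refine ⟨⟨upper u.1 u.1.d₁ (u.1.d₂ + 1) (u.1.l - 1), ?_⟩, ?_⟩ <;>
        simp only [Valid, upper, true_and, and_true] <;> omega
    · refine ⟨⟨upper u.1 (u.1.d₁ + 1) u.1.d₂ u.1.l, ?_⟩, ?_⟩ <;>
        simp only [Valid, upper, true_and, and_true] <;> omega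
  · intro v hyp
    have hv := v.2
    simp only [edge₁, Edge₁, t, Valid, if_true] at *
    by_cases hl : v.1.l < v.1.a₂ + v.1.d₁
    · refine ⟨⟨upper v.1 (v.1.d₁ - 1) v.1.d₂ v.1.l, ?_⟩, ?_⟩ <;>
        simp only [Valid, upper, true_and, and_true] <;> omega
    · refine ⟨⟨upper v.1 v.1.d₁ (v.1.d₂ - 1) (v.1.l + 1), ?_⟩, ?_⟩ <;>
        simp only [Valid, upper, true_and] <;> omega
  · intro u
    have hu := u.2
    simp only [h, Valid, if_true] at *
    omega
  · intro u
    have hu := u.2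
    simp only [t, Valid, if_true] at *
    omega
  · intro u v e
    simp only [edge₁, Edge₁, h, if_true] at *
    omega
  · intro u v e
    simp only [edge₁, Edge₁, t, if_true] at *
    omega

lemma colorAxioms_two : ColorAxioms (Model c₁ c₂) h t 2 := by
  refine ⟨?_, ?_, ?_, ?_, ?_, ?_, ?_⟩
  · intro u u' v e e'
    rw [edge₂] at e e'
    unfold Edge₂ at e e'
    refine Subtype.ext (Coord.ext ?_ ?_ ?_ ?_ ?_ ?_) <;> omega
  · intro u hyp
    have hu := u.2
    simp only [edge₂, Edge₂, h, Valid, if_true, if_false, OfNat.ofNat_ne_one] at *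
    refine ⟨⟨upper u.1 u.1.d₁ u.1.d₂ (u.1.l + 1), ?_⟩, ?_⟩ <;>
      simp only [Valid, upper, and_true] <;> omega
  · intro v hyp
    have hv := v.2
    simp only [edge₂, Edge₂, t, Valid, if_true, if_false, OfNat.ofNat_ne_one] at *
    refine ⟨⟨upper v.1 v.1.d₁ v.1.d₂ (v.1.l - 1), ?_⟩, ?_⟩ <;>
      simp only [Valid, upper, true_and] <;> omega
  · intro u
    have hu := u.2
    simp only [h, Valid, if_true, if_false, OfNat.ofNat_ne_one] at *
    omega
  · intro u
    have hu := u.2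
    simp only [t, Valid, if_true, if_false, OfNat.ofNat_ne_one] at *
    omega
  · intro u v e
    simp only [edge₂, Edge₂, h, if_true, if_false, OfNat.ofNat_ne_one] at *
    omega
  · intro u v e
    simp only [edge₂, Edge₂, t, if_true, if_false, OfNat.ofNat_ne_one] at *
    omega

lemma colorAxioms_three : ColorAxioms (Model c₁ c₂) h t 3 := by
  have C := colorAxioms_one (c₁ := c₁) (c₂ := c₂)
  have hh : ∀ x : (Model c₁ c₂).V, h 3 x = h 1 (inv x) := fun x => (h_inv (by simp [Col]) x).symm
  have ht : ∀ x : (Model c₁ c₂).V, t 3 x = t 1 (inv x) := fun x => (t_inv (by simp [Col]) x).symm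
  refine ⟨?_, ?_, ?_, ?_, ?_, ?_, ?_⟩
  · intro u u' v e e'
    rw [← inv_inv u, C.inj (edge_inv_of_edge e) (edge_inv_of_edge e'), inv_inv]
  · intro u hyp
    obtain ⟨v, e⟩ := C.hpos (hh u ▸ hyp)
    exact ⟨inv v, edge_inv_right e⟩
  · intro v hyp
    obtain ⟨u, e⟩ := C.tpos (ht v ▸ hyp)
    exact ⟨inv u, edge_inv_left e⟩
  · intro u
    exact hh u ▸ C.hnn
  · intro u
    exact ht u ▸ C.tnn
  · intro u v e
    rw [hh, hh, C.hstep (edge_inv_of_edge e)]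
  · intro u v e
    rw [ht, ht, C.tstep (edge_inv_of_edge e)]

lemma colorAxioms {i : ℕ} (hi : Col i) : ColorAxioms (Model c₁ c₂) h t i := by
  have : i = 1 ∨ i = 2 ∨ i = 3 := by unfold Col at hi; omega
  obtain rfl | rfl | rfl := this
  · exact colorAxioms_one
  · exact colorAxioms_two
  · exact colorAxioms_three

lemma far_one_three {u v : (Model c₁ c₂).V} (e : (Model c₁ c₂).F 1 u = some v) :
    h 3 v = h 3 u ∧ t 3 v = t 3 u := by
  have hu := u.2
  have hv := v.2
  simp only [edge₁, Edge₁, h, t, Valid, if_false, OfNat.ofNat_ne_one,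
    Nat.succ_ne_self] at *
  omega

lemma far_three_one {u v : (Model c₁ c₂).V} (e : (Model c₁ c₂).F 3 u = some v) :
    h 1 v = h 1 u ∧ t 1 v = t 1 u := by
  have := far_one_three (edge_inv_of_edge e)
  have h1 := h_inv (c₁ := c₁) (c₂ := c₂) (i := 1) (by simp [Col])
  have t1 := t_inv (c₁ := c₁) (c₂ := c₂) (i := 1) (by simp [Col])
  rw [← h1 u, ← h1 v, ← t1 u, ← t1 v]
  exact this

lemma commute_one_three {u v v' : (Model c₁ c₂).V} (e : (Model c₁ c₂).F 1 u = some v)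
    (e' : (Model c₁ c₂).F 3 u = some v') :
    ∃ w, (Model c₁ c₂).F 3 v = some w ∧ (Model c₁ c₂).F 1 v' = some w := by
  have hu := u.2
  have hv := v.2
  have hv' := v'.2
  simp only [edge₁, edge₃, Edge₁, Edge₃, Valid] at *
  by_cases hl : v'.1.a₂ + v'.1.d₁ < v'.1.l
  · refine ⟨⟨upper v'.1 v'.1.d₁ (v'.1.d₂ + 1) (v'.1.l - 1), ?_⟩, ?_, ?_⟩ <;>
      simp only [Valid, upper, true_and, and_true] <;>
      rcases e with ⟨e₁, e₂, e₃, e₄ | e₄⟩ <;>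
      rcases e' with ⟨g₁, g₂, g₃, g₄, g₅, g₆ | g₆⟩ | ⟨g₁, g₂, g₃, g₄, g₅, g₆ | g₆⟩ <;> omega
  · refine ⟨⟨upper v'.1 (v'.1.d₁ + 1) v'.1.d₂ v'.1.l, ?_⟩, ?_, ?_⟩ <;>
      simp only [Valid, upper, true_and, and_true] <;>
      rcases e with ⟨e₁, e₂, e₃, e₄ | e₄⟩ <;>
      rcases e' with ⟨g₁, g₂, g₃, g₄, g₅, g₆ | g₆⟩ | ⟨g₁, g₂, g₃, g₄, g₅, g₆ | g₆⟩ <;> omega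

lemma commute_dual_one_three {u u' v : (Model c₁ c₂).V} (e : (Model c₁ c₂).F 1 u = some v)
    (e' : (Model c₁ c₂).F 3 u' = some v) :
    ∃ w, (Model c₁ c₂).F 3 w = some u ∧ (Model c₁ c₂).F 1 w = some u' := by
  have hu := u.2
  have hu' := u'.2
  have hv := v.2
  simp only [edge₁, edge₃, Edge₁, Edge₃, Valid] at *
  by_cases hl : u'.1.l < u'.1.a₂ + u'.1.d₁
  · refine ⟨⟨upper u'.1 (u'.1.d₁ - 1) u'.1.d₂ u'.1.l, ?_⟩, ?_, ?_⟩ <;>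
      simp only [Valid, upper, true_and, and_true] <;>
      rcases e with ⟨e₁, e₂, e₃, e₄ | e₄⟩ <;>
      rcases e' with ⟨g₁, g₂, g₃, g₄, g₅, g₆ | g₆⟩ | ⟨g₁, g₂, g₃, g₄, g₅, g₆ | g₆⟩ <;> omega
  · refine ⟨⟨upper u'.1 u'.1.d₁ (u'.1.d₂ - 1) (u'.1.l + 1), ?_⟩, ?_, ?_⟩ <;>
      simp only [Valid, upper, true_and] <;>
      rcases e with ⟨e₁, e₂, e₃, e₄ | e₄⟩ <;>
      rcases e' with ⟨g₁, g₂, g₃, g₄, g₅, g₆ | g₆⟩ | ⟨g₁, g₂, g₃, g₄, g₅, g₆ | g₆⟩ <;> omega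

theorem regular (c₁ c₂ : ℤ) : Axioms (Model c₁ c₂) h t where
  col := col
  inj e e' := (colorAxioms (col e)).inj e e'
  hpos hi := (colorAxioms hi).hpos
  tpos hi := (colorAxioms hi).tpos
  hnn hi := (colorAxioms hi).hnn
  tnn hi := (colorAxioms hi).tnn
  hstep e := (colorAxioms (col e)).hstep e
  tstep e := (colorAxioms (col e)).tstep e
  near e hj hij := (nearAxioms (col e) hj hij).near e
  far {i j u v} e hj hij := by
    have hi := col e
    have : i = 1 ∧ j = 3 ∨ i = 3 ∧ j = 1 := by unfold Col Far at *; omega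
    obtain ⟨rfl, rfl⟩ | ⟨rfl, rfl⟩ := this
    · exact far_one_three e
    · exact far_three_one e
  square e e' hij := (nearAxioms (col e) (col e') hij).square e e'
  square_dual e e' hij := (nearAxioms (col e) (col e') hij).square_dual e e'
  verma e e' hij := (nearAxioms (col e) (col e') hij).verma e e'
  verma_dual e e' hij := (nearAxioms (col e) (col e') hij).verma_dual e e'
  commute {i j u v v'} e e' hij := by
    have hi := col e
    have hj := col e'
    have : i = 1 ∧ j = 3 ∨ i = 3 ∧ j = 1 := by unfold Col Far at *; omega
    obtain ⟨rfl, rfl⟩ | ⟨rfl, rfl⟩ := this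
    · exact commute_one_three e e'
    · obtain ⟨w, e1, e2⟩ := commute_one_three e' e
      exact ⟨w, e2, e1⟩
  commute_dual {i j u u' v} e e' hij := by
    have hi := col e
    have hj := col e'
    have : i = 1 ∧ j = 3 ∨ i = 3 ∧ j = 1 := by unfold Col Far at *; omega
    obtain ⟨rfl, rfl⟩ | ⟨rfl, rfl⟩ := this
    · exact commute_dual_one_three e e'
    · obtain ⟨w, e1, e2⟩ := commute_dual_one_three e' e
      exact ⟨w, e2, e1⟩

/-- The source of the model. -/
def origin (h₁ : 0 ≤ c₁) (h₂ : 0 ≤ c₂) : (Model c₁ c₂).V :=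
  ⟨⟨0, 0, 0, 0, 0, 0⟩, by simp [Valid, h₁, h₂]⟩

lemma exists_reach (h₁ : 0 ≤ c₁) (h₂ : 0 ≤ c₂) (x : (Model c₁ c₂).V) :
    ∃ n, Reach (Model c₁ c₂) (origin h₁ h₂) n x := by
  have nonneg : ∀ x : (Model c₁ c₂).V, 0 ≤ x.1.depth := by
    intro x
    have hx := x.2
    unfold Valid at hx
    unfold depth
    omega
  have step : ∀ {i} {x y : (Model c₁ c₂).V}, (Model c₁ c₂).F i x = some y →
      y.1.depth = x.1.depth + 1 := by
    intro i x y e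
    have hi := col e
    have : i = 1 ∨ i = 2 ∨ i = 3 := by unfold Col at hi; omega
    unfold depth
    obtain rfl | rfl | rfl := this <;>
      simp only [edge₁, edge₂, edge₃, Edge₁, Edge₂, Edge₃] at e <;> omega
  obtain ⟨n, hn⟩ : ∃ n : ℕ, x.1.depth.toNat = n := ⟨_, rfl⟩
  induction n generalizing x with
  | zero =>
    have hx := x.2
    have hd : x.1.depth.toNat = 0 := hn
    unfold Valid at hx
    unfold depth at hd
    have : x = origin h₁ h₂ := by
      refine Subtype.ext (Coord.ext ?_ ?_ ?_ ?_ ?_ ?_) <;> simp only [origin] <;> omega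
    exact ⟨0, this ▸ .base⟩
  | succ n ih =>
    have : 0 < t 1 x ∨ 0 < t 2 x ∨ 0 < t 3 x := by
      have hx := x.2
      unfold depth at hn
      simp only [t, Valid, if_true, if_false, OfNat.ofNat_ne_one,
        Nat.succ_ne_self] at *
      omega
    obtain ⟨i, hi, ht⟩ : ∃ i, Col i ∧ 0 < t i x := by
      rcases this with h | h | h
      exacts [⟨1, by simp [Col], h⟩, ⟨2, by simp [Col], h⟩, ⟨3, by simp [Col], h⟩]
    obtain ⟨u, e⟩ := (colorAxioms hi).tpos ht
    have := step e
    have := nonneg u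
    obtain ⟨k, r⟩ := ih u (by omega)
    exact ⟨k + 1, .step i r e⟩

end Model
/-! ### Operator strings and subcrystals in coordinates -/

/-- Coordinates on the vertices of `K` identifying it with the model of `K(c₁, c₂, c₁)`. -/
structure Chart (K : PreGraph) (c₁ c₂ : ℤ) where
  x : K.V → Coord
  inj : Function.Injective x
  valid : ∀ v, (x v).Valid c₁ c₂
  surj : ∀ y : Coord, y.Valid c₁ c₂ → ∃ v, x v = y
  edge₁ : ∀ {u v}, K.F 1 u = some v ↔ Edge₁ (x u) (x v)
  edge₂ : ∀ {u v}, K.F 2 u = some v ↔ Edge₂ (x u) (x v)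
  edge₃ : ∀ {u v}, K.F 3 u = some v ↔ Edge₃ (x u) (x v)

lemma applyStr_append (G : PreGraph) (L L' : List ℕ) (u : G.V) :
    applyStr G (L ++ L') u = (applyStr G L u).bind (applyStr G L') := by
  induction L generalizing u with
  | nil => rfl
  | cons i L ih =>
    simp only [List.cons_append, applyStr, Option.bind_assoc]
    exact congrArg _ (funext ih)

lemma applyStr_append_eq_some {G : PreGraph} {L L' : List ℕ} {u w : G.V} :
    applyStr G (L ++ L') u = some w ↔ ∃ v, applyStr G L u = some v ∧ applyStr G L' v = some w := by
  rw [applyStr_append, Option.bind_eq_some_iff]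

lemma applyStr_replicate_invariant {G : PreGraph} {S : List ℕ} {P : ℕ → G.V → Prop}
    (step : ∀ k u v, P k u → applyStr G S u = some v → P (k + 1) v) {n : ℕ} {u v : G.V}
    (hu : P 0 u) (e : applyStr G (List.replicate n S).flatten u = some v) : P n v := by
  induction n generalizing v with
  | zero =>
    simp only [List.replicate_zero, List.flatten_nil, applyStr, Option.some.injEq] at e
    exact e ▸ hu
  | succ n ih =>
    rw [List.replicate_succ', List.flatten_append, applyStr_append_eq_some] at e
    obtain ⟨w, e1, e2⟩ := e
    exact step n w v (ih e1) (by simpa using e2)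

lemma exists_applyStr_replicate {G : PreGraph} {S : List ℕ} {P : ℕ → G.V → Prop} {n : ℕ}
    (step : ∀ k u, k < n → P k u → ∃ v, applyStr G S u = some v ∧ P (k + 1) v) {u : G.V}
    (hu : P 0 u) : ∃ v, applyStr G (List.replicate n S).flatten u = some v ∧ P n v := by
  induction n with
  | zero => exact ⟨u, by simp [applyStr], hu⟩
  | succ n ih =>
    obtain ⟨w, e1, hw⟩ := ih fun k u hk => step k u (by omega)
    obtain ⟨v, e2, hv⟩ := step n w (by omega) hw
    refine ⟨v, ?_, hv⟩
    rw [List.replicate_succ', List.flatten_append, applyStr_append_eq_some]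
    exact ⟨w, e1, by simpa using e2⟩

lemma prinStr_three (a : ℕ → ℕ) :
    prinStr 0 3 a = (List.replicate (a 1) [1, 2, 3]).flatten ++
      ((List.replicate (a 2) [2, 1, 3, 2]).flatten ++ (List.replicate (a 3) [3, 2, 1]).flatten) := by
  simp [prinStr, SStr, wStr, List.range_succ]

lemma prinStr_two (a : ℕ → ℕ) :
    prinStr 0 2 a = (List.replicate (a 1) [1, 2]).flatten ++
      (List.replicate (a 2) [2, 1]).flatten := by
  simp [prinStr, SStr, wStr, List.range_succ]

lemma sub_edge {K : PreGraph} {I : Set ℕ} {p : K.V} {i : ℕ} {u v : (K.sub I p).V} :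
    (K.sub I p).F i u = some v ↔ i ∈ I ∧ K.F i u.1 = some v.1 := by
  by_cases hi : i ∈ I
  · refine (iff_of_eq (congrArg (· = some v) (dif_pos hi))).trans
      (Option.pbind_eq_some_iff.trans ?_)
    constructor
    · rintro ⟨w, hw, e⟩
      exact ⟨hi, Option.some.inj e ▸ hw⟩
    · rintro ⟨-, e⟩
      exact ⟨v.1, e, rfl⟩
  · refine (iff_of_eq (congrArg (· = some v) (dif_neg hi))).trans ?_
    simp [hi]

lemma sub_applyStr {K : PreGraph} {I : Set ℕ} {p : K.V} {L : List ℕ} (hL : ∀ i ∈ L, i ∈ I)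
    {u v : (K.sub I p).V} :
    applyStr (K.sub I p) L u = some v ↔ applyStr K L u.1 = some v.1 := by
  induction L generalizing u with
  | nil =>
    simp only [applyStr, Option.some.injEq]
    exact Subtype.ext_iff
  | cons i L ih =>
    simp only [List.mem_cons, forall_eq_or_imp] at hL
    simp only [applyStr, Option.bind_eq_some_iff]
    constructor
    · rintro ⟨w, e1, e2⟩
      exact ⟨w.1, (sub_edge.1 e1).2, (ih hL.2).1 e2⟩
    · rintro ⟨w, e1, e2⟩
      have hw : inComp K I p w := u.2.tail ⟨i, hL.1, .inl e1⟩
      exact ⟨⟨w, hw⟩, sub_edge.2 ⟨hL.1, e1⟩, (ih hL.2).2 e2⟩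

lemma inComp.symm {K : PreGraph} {I : Set ℕ} {u v : K.V} (h : inComp K I u v) :
    inComp K I v u := by
  induction h with
  | refl => exact .refl
  | tail _ e ih =>
    obtain ⟨i, hi, e⟩ := e
    exact .head ⟨i, hi, e.symm⟩ ih

namespace Chart

variable {K : PreGraph} {c₁ c₂ : ℤ} (χ : Chart K c₁ c₂)

/-- `v` has coordinates `(a₁, a₂, a₃, d₁, d₂, l)`. -/
def At (v : K.V) (a₁ a₂ a₃ d₁ d₂ l : ℤ) : Prop :=
  (χ.x v).a₁ = a₁ ∧ (χ.x v).a₂ = a₂ ∧ (χ.x v).a₃ = a₃ ∧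
  (χ.x v).d₁ = d₁ ∧ (χ.x v).d₂ = d₂ ∧ (χ.x v).l = l

variable {χ}

lemma At.unique {u v : K.V} {a₁ a₂ a₃ d₁ d₂ l : ℤ} (hu : χ.At u a₁ a₂ a₃ d₁ d₂ l)
    (hv : χ.At v a₁ a₂ a₃ d₁ d₂ l) : u = v := by
  unfold At at hu hv
  exact χ.inj (Coord.ext (by omega) (by omega) (by omega) (by omega) (by omega) (by omega))

lemma exists_at (χ : Chart K c₁ c₂) (a₁ a₂ a₃ d₁ d₂ l : ℤ)
    (hv : Valid c₁ c₂ ⟨a₁, a₂, a₃, d₁, d₂, l⟩) : ∃ v, χ.At v a₁ a₂ a₃ d₁ d₂ l := by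
  obtain ⟨v, e⟩ := χ.surj _ hv
  exact ⟨v, by simp [At, e]⟩

lemma at_of_applyStr₁ {u v : K.V} {a₁ a₂ a₃ : ℤ} (hu : χ.At u a₁ a₂ a₃ 0 0 a₂)
    (e : applyStr K [1, 2, 3] u = some v) : χ.At v (a₁ + 1) a₂ a₃ 0 0 a₂ := by
  simp only [applyStr, Option.bind_eq_some_iff, Option.some.injEq, exists_eq_right, χ.edge₁,
    χ.edge₂, χ.edge₃, Edge₁, Edge₂, Edge₃, At] at *
  obtain ⟨w, e1, y, e2, e3⟩ := e
  omega

lemma at_of_applyStr₂ {u v : K.V} {a₁ a₂ a₃ : ℤ} (hu : χ.At u a₁ a₂ a₃ 0 0 a₂)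
    (e : applyStr K [2, 1, 3, 2] u = some v) : χ.At v a₁ (a₂ + 1) a₃ 0 0 (a₂ + 1) := by
  simp only [applyStr, Option.bind_eq_some_iff, Option.some.injEq, exists_eq_right, χ.edge₁,
    χ.edge₂, χ.edge₃, Edge₁, Edge₂, Edge₃, At] at *
  obtain ⟨w, e1, y, e2, z, e3, e4⟩ := e
  omega

lemma at_of_applyStr₃ {u v : K.V} {a₁ a₂ a₃ : ℤ} (hu : χ.At u a₁ a₂ a₃ 0 0 a₂)
    (e : applyStr K [3, 2, 1] u = some v) : χ.At v a₁ a₂ (a₃ + 1) 0 0 a₂ := by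
  simp only [applyStr, Option.bind_eq_some_iff, Option.some.injEq, exists_eq_right, χ.edge₁,
    χ.edge₂, χ.edge₃, Edge₁, Edge₂, Edge₃, At] at *
  obtain ⟨w, e1, y, e2, e3⟩ := e
  omega

lemma exists_applyStr₁ {u : K.V} {a₁ a₂ a₃ : ℤ} (hu : χ.At u a₁ a₂ a₃ 0 0 a₂)
    (ha : a₁ < c₁) : ∃ v, applyStr K [1, 2, 3] u = some v := by
  have hv := χ.valid u
  simp only [At, Valid] at hu hv
  obtain ⟨w, hw⟩ := χ.exists_at a₁ a₂ a₃ 1 0 a₂ (by simp only [Valid]; omega)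
  obtain ⟨y, hy⟩ := χ.exists_at a₁ a₂ a₃ 1 0 (a₂ + 1) (by simp only [Valid]; omega)
  obtain ⟨v, hv⟩ := χ.exists_at (a₁ + 1) a₂ a₃ 0 0 a₂ (by simp only [Valid]; omega)
  simp only [applyStr, Option.bind_eq_some_iff, Option.some.injEq, exists_eq_right, χ.edge₁,
    χ.edge₂, χ.edge₃, Edge₁, Edge₂, Edge₃, At] at *
  exact ⟨v, w, by omega, y, by omega, by omega⟩

lemma exists_applyStr₂ {u : K.V} {a₁ a₂ a₃ : ℤ} (hu : χ.At u a₁ a₂ a₃ 0 0 a₂)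
    (ha : a₂ < c₂) : ∃ v, applyStr K [2, 1, 3, 2] u = some v := by
  have hv := χ.valid u
  simp only [At, Valid] at hu hv
  obtain ⟨w, hw⟩ := χ.exists_at a₁ a₂ a₃ 0 0 (a₂ + 1) (by simp only [Valid]; omega)
  obtain ⟨y, hy⟩ := χ.exists_at a₁ a₂ a₃ 0 1 a₂ (by simp only [Valid]; omega)
  obtain ⟨z, hz⟩ := χ.exists_at a₁ (a₂ + 1) a₃ 0 0 a₂ (by simp only [Valid]; omega)
  obtain ⟨v, hv⟩ := χ.exists_at a₁ (a₂ + 1) a₃ 0 0 (a₂ + 1) (by simp only [Valid]; omega)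
  simp only [applyStr, Option.bind_eq_some_iff, Option.some.injEq, exists_eq_right, χ.edge₁,
    χ.edge₂, χ.edge₃, Edge₁, Edge₂, Edge₃, At] at *
  exact ⟨v, w, by omega, y, by omega, z, by omega, by omega⟩

lemma exists_applyStr₃ {u : K.V} {a₁ a₂ a₃ : ℤ} (hu : χ.At u a₁ a₂ a₃ 0 0 a₂)
    (ha : a₃ < c₁) : ∃ v, applyStr K [3, 2, 1] u = some v := by
  have hv := χ.valid u
  simp only [At, Valid] at hu hv
  obtain ⟨w, hw⟩ := χ.exists_at a₁ a₂ (a₃ + 1) 0 (-1) a₂ (by simp only [Valid]; omega)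
  obtain ⟨y, hy⟩ := χ.exists_at a₁ a₂ (a₃ + 1) 0 (-1) (a₂ + 1) (by simp only [Valid]; omega)
  obtain ⟨v, hv⟩ := χ.exists_at a₁ a₂ (a₃ + 1) 0 0 a₂ (by simp only [Valid]; omega)
  simp only [applyStr, Option.bind_eq_some_iff, Option.some.injEq, exists_eq_right, χ.edge₁,
    χ.edge₂, χ.edge₃, Edge₁, Edge₂, Edge₃, At] at *
  exact ⟨v, w, by omega, y, by omega, by omega⟩

lemma at_of_isPrin {s p : K.V} {a : ℕ → ℕ} (hs : χ.At s 0 0 0 0 0 0) (e : IsPrin K 0 3 s a p) :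
    χ.At p (a 1) (a 2) (a 3) 0 0 (a 2) := by
  simp only [IsPrin, prinOpt, prinStr_three, applyStr_append_eq_some] at e
  obtain ⟨u, e1, v, e2, e3⟩ := e
  have hu := applyStr_replicate_invariant (P := fun k u => χ.At u k 0 0 0 0 0)
    (fun k u v hk e => by simpa using at_of_applyStr₁ hk e) (by simpa using hs) e1
  have hv := applyStr_replicate_invariant (P := fun k u => χ.At u (a 1) k 0 0 0 k)
    (fun k u v hk e => by simpa using at_of_applyStr₂ hk e) (by simpa using hu) e2
  exact applyStr_replicate_invariant (P := fun k u => χ.At u (a 1) (a 2) k 0 0 (a 2))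
    (fun k u v hk e => by simpa using at_of_applyStr₃ hk e) (by simpa using hv) e3

lemma exists_isPrin {s : K.V} {a : ℕ → ℕ} (hs : χ.At s 0 0 0 0 0 0) (h₁ : (a 1 : ℤ) ≤ c₁)
    (h₂ : (a 2 : ℤ) ≤ c₂) (h₃ : (a 3 : ℤ) ≤ c₁) : ∃ p, IsPrin K 0 3 s a p := by
  simp only [IsPrin, prinOpt, prinStr_three, applyStr_append_eq_some]
  obtain ⟨u, e1, hu⟩ := exists_applyStr_replicate (P := fun k u => χ.At u k 0 0 0 0 0)
    (n := a 1) (S := [1, 2, 3]) (fun k u hk hu => by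
      obtain ⟨v, e⟩ := exists_applyStr₁ hu (by omega)
      exact ⟨v, e, by simpa using at_of_applyStr₁ hu e⟩) (by simpa using hs)
  obtain ⟨v, e2, hv⟩ := exists_applyStr_replicate (P := fun k u => χ.At u (a 1) k 0 0 0 k)
    (n := a 2) (S := [2, 1, 3, 2]) (fun k u hk hu => by
      obtain ⟨v, e⟩ := exists_applyStr₂ hu (by omega)
      exact ⟨v, e, by simpa using at_of_applyStr₂ hu e⟩) (by simpa using hu)
  obtain ⟨w, e3, hw⟩ := exists_applyStr_replicate
    (P := fun k u => χ.At u (a 1) (a 2) k 0 0 (a 2))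
    (n := a 3) (S := [3, 2, 1]) (fun k u hk hu => by
      obtain ⟨v, e⟩ := exists_applyStr₃ hu (by omega)
      exact ⟨v, e, by simpa using at_of_applyStr₃ hu e⟩) (by simpa using hv)
  exact ⟨w, u, e1, v, e2, e3⟩

end Chart
namespace Chart

variable {K : PreGraph} {c₁ c₂ : ℤ} {χ : Chart K c₁ c₂}

lemma at_of_applyStr_upper₁ {u v : K.V} {a₁ a₂ a₃ d₁ d₂ : ℤ}
    (hu : χ.At u a₁ a₂ a₃ d₁ d₂ (a₂ + d₁)) (e : applyStr K [1, 2] u = some v) :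
    χ.At v a₁ a₂ a₃ (d₁ + 1) d₂ (a₂ + (d₁ + 1)) := by
  simp only [applyStr, Option.bind_eq_some_iff, Option.some.injEq, exists_eq_right, χ.edge₁,
    χ.edge₂, Edge₁, Edge₂, At] at *
  obtain ⟨w, e1, e2⟩ := e
  omega

lemma at_of_applyStr_upper₂ {u v : K.V} {a₁ a₂ a₃ d₁ d₂ : ℤ}
    (hu : χ.At u a₁ a₂ a₃ d₁ d₂ (a₂ + d₁)) (e : applyStr K [2, 1] u = some v) :
    χ.At v a₁ a₂ a₃ d₁ (d₂ + 1) (a₂ + d₁) := by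
  simp only [applyStr, Option.bind_eq_some_iff, Option.some.injEq, exists_eq_right, χ.edge₁,
    χ.edge₂, Edge₁, Edge₂, At] at *
  obtain ⟨w, e1, e2⟩ := e
  omega

lemma exists_applyStr_upper₁ {u : K.V} {a₁ a₂ a₃ d₁ d₂ : ℤ}
    (hu : χ.At u a₁ a₂ a₃ d₁ d₂ (a₂ + d₁)) (hd : d₁ < c₁ - a₁) :
    ∃ v, applyStr K [1, 2] u = some v := by
  have hv := χ.valid u
  simp only [At, Valid] at hu hv
  obtain ⟨w, hw⟩ := χ.exists_at a₁ a₂ a₃ (d₁ + 1) d₂ (a₂ + d₁) (by simp only [Valid]; omega)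
  obtain ⟨v, hv⟩ := χ.exists_at a₁ a₂ a₃ (d₁ + 1) d₂ (a₂ + d₁ + 1) (by simp only [Valid]; omega)
  simp only [applyStr, Option.bind_eq_some_iff, Option.some.injEq, exists_eq_right, χ.edge₁,
    χ.edge₂, Edge₁, Edge₂, At] at *
  exact ⟨v, w, by omega, by omega⟩

lemma exists_applyStr_upper₂ {u : K.V} {a₁ a₂ a₃ d₁ d₂ : ℤ}
    (hu : χ.At u a₁ a₂ a₃ d₁ d₂ (a₂ + d₁)) (hd : d₂ < c₂ - a₂) :
    ∃ v, applyStr K [2, 1] u = some v := by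
  have hv := χ.valid u
  simp only [At, Valid] at hu hv
  obtain ⟨w, hw⟩ := χ.exists_at a₁ a₂ a₃ d₁ d₂ (a₂ + d₁ + 1) (by simp only [Valid]; omega)
  obtain ⟨v, hv⟩ := χ.exists_at a₁ a₂ a₃ d₁ (d₂ + 1) (a₂ + d₁) (by simp only [Valid]; omega)
  simp only [applyStr, Option.bind_eq_some_iff, Option.some.injEq, exists_eq_right, χ.edge₁,
    χ.edge₂, Edge₁, Edge₂, At] at *
  exact ⟨v, w, by omega, by omega⟩

lemma mem_of_mem_prinStr_two {p : ℕ → ℕ} {i : ℕ} (hi : i ∈ prinStr 0 2 p) :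
    i ∈ Set.Icc 1 2 := by
  rw [prinStr_two, List.mem_append, List.mem_flatten, List.mem_flatten] at hi
  obtain ⟨L, hL, hi⟩ | ⟨L, hL, hi⟩ := hi <;>
  · rw [List.eq_of_mem_replicate hL] at hi
    simp only [List.mem_cons, List.not_mem_nil, or_false] at hi
    rw [Set.mem_Icc]
    omega

lemma at_of_isPrin_sub {r : K.V} {s z : (K.sub (Set.Icc 1 2) r).V} {p : ℕ → ℕ}
    {a₁ a₂ a₃ : ℤ} (hs : χ.At s.1 a₁ a₂ a₃ (-a₂) (-a₃) 0)
    (e : IsPrin (K.sub (Set.Icc 1 2) r) 0 2 s p z) :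
    χ.At z.1 a₁ a₂ a₃ (p 1 - a₂) (p 2 - a₃) (p 1) := by
  rw [IsPrin, prinOpt, sub_applyStr fun _ => mem_of_mem_prinStr_two, prinStr_two,
    applyStr_append_eq_some] at e
  obtain ⟨u, e1, e2⟩ := e
  have hu := applyStr_replicate_invariant
    (P := fun k u => χ.At u a₁ a₂ a₃ (k - a₂) (-a₃) (a₂ + (k - a₂)))
    (fun k u v hk e => by
      have := at_of_applyStr_upper₁ hk e
      rwa [show (k : ℤ) - a₂ + 1 = (k + 1 : ℕ) - a₂ by push_cast; ring] at this)
    (by simpa using hs) e1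
  have hz := applyStr_replicate_invariant
    (P := fun k u => χ.At u a₁ a₂ a₃ (p 1 - a₂) (k - a₃) (a₂ + (p 1 - a₂)))
    (fun k u v hk e => by
      have := at_of_applyStr_upper₂ hk e
      rwa [show (k : ℤ) - a₃ + 1 = (k + 1 : ℕ) - a₃ by push_cast; ring] at this)
    (by simpa using hu) e2
  simpa using hz

lemma exists_isPrin_sub {r : K.V} {s : (K.sub (Set.Icc 1 2) r).V} {p : ℕ → ℕ}
    {a₁ a₂ a₃ : ℤ} (hs : χ.At s.1 a₁ a₂ a₃ (-a₂) (-a₃) 0) (h₁ : p 1 ≤ c₁ - a₁ + a₂)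
    (h₂ : p 2 ≤ c₂ - a₂ + a₃) : ∃ z, IsPrin (K.sub (Set.Icc 1 2) r) 0 2 s p z := by
  obtain ⟨u, e1, hu⟩ := exists_applyStr_replicate
    (P := fun k u => χ.At u a₁ a₂ a₃ (k - a₂) (-a₃) (a₂ + (k - a₂)))
    (n := p 1) (S := [1, 2]) (fun k u hk hu => by
      obtain ⟨v, e⟩ := exists_applyStr_upper₁ hu (by omega)
      have := at_of_applyStr_upper₁ hu e
      rw [show (k : ℤ) - a₂ + 1 = (k + 1 : ℕ) - a₂ by push_cast; ring] at this
      exact ⟨v, e, this⟩) (u := s.1) (by simpa using hs)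
  obtain ⟨z, e2, hz⟩ := exists_applyStr_replicate
    (P := fun k u => χ.At u a₁ a₂ a₃ (p 1 - a₂) (k - a₃) (a₂ + (p 1 - a₂)))
    (n := p 2) (S := [2, 1]) (fun k u hk hu => by
      obtain ⟨v, e⟩ := exists_applyStr_upper₂ hu (by omega)
      have := at_of_applyStr_upper₂ hu e
      rw [show (k : ℤ) - a₃ + 1 = (k + 1 : ℕ) - a₃ by push_cast; ring] at this
      exact ⟨v, e, this⟩) (u := u) (by simpa using hu)
  have e : applyStr K (prinStr 0 2 p) s.1 = some z := by
    rw [prinStr_two, applyStr_append_eq_some]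
    exact ⟨u, e1, e2⟩
  have reach : ∀ (L : List ℕ) (u v : K.V), (∀ i ∈ L, i ∈ Set.Icc 1 2) →
      applyStr K L u = some v → inComp K (Set.Icc 1 2) u v := by
    intro L
    induction L with
    | nil =>
      intro u v _ e
      exact Option.some.inj e ▸ .refl
    | cons i L ih =>
      intro u v hL e
      simp only [List.mem_cons, forall_eq_or_imp] at hL
      obtain ⟨w, e1, e2⟩ := Option.bind_eq_some_iff.1 e
      exact .head ⟨i, hL.1, .inl e1⟩ (ih w v hL.2 e2)
  refine ⟨⟨z, s.2.trans (reach _ _ _ (fun _ => mem_of_mem_prinStr_two) e)⟩, ?_⟩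
  exact (sub_applyStr fun _ => mem_of_mem_prinStr_two).2 e

lemma eq_of_inComp_upper {u v : K.V} (h : inComp K (Set.Icc 1 2) u v) :
    (χ.x v).a₁ = (χ.x u).a₁ ∧ (χ.x v).a₂ = (χ.x u).a₂ ∧ (χ.x v).a₃ = (χ.x u).a₃ := by
  induction h with
  | refl => simp
  | tail _ e ih =>
    obtain ⟨i, hi, e⟩ := e
    have : i = 1 ∨ i = 2 := by rw [Set.mem_Icc] at hi; omega
    rcases this with rfl | rfl
    · simp only [χ.edge₁, Edge₁] at e
      omega
    · simp only [χ.edge₂, Edge₂] at e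
      omega

lemma exists_pred (v : K.V)
    (hv : ¬ χ.At v (χ.x v).a₁ (χ.x v).a₂ (χ.x v).a₃ (-(χ.x v).a₂) (-(χ.x v).a₃) 0) :
    ∃ i ∈ Set.Icc 1 2, ∃ u, K.F i u = some v ∧
      (χ.x u).d₁ + 2 * (χ.x u).d₂ + (χ.x u).l + 1 = (χ.x v).d₁ + 2 * (χ.x v).d₂ + (χ.x v).l := by
  have hval := χ.valid v
  simp only [Valid, At, true_and] at hval hv
  by_cases hl : 0 < (χ.x v).l
  · obtain ⟨u, hu⟩ := χ.exists_at (χ.x v).a₁ (χ.x v).a₂ (χ.x v).a₃ (χ.x v).d₁ (χ.x v).d₂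
      ((χ.x v).l - 1) (by simp only [Valid]; omega)
    simp only [At] at hu
    exact ⟨2, by simp, u, by simp only [χ.edge₂, Edge₂]; omega, by omega⟩
  by_cases hd : 0 < (χ.x v).a₂ + (χ.x v).d₁
  · obtain ⟨u, hu⟩ := χ.exists_at (χ.x v).a₁ (χ.x v).a₂ (χ.x v).a₃ ((χ.x v).d₁ - 1) (χ.x v).d₂
      (χ.x v).l (by simp only [Valid]; omega)
    simp only [At] at hu
    exact ⟨1, by simp, u, by simp only [χ.edge₁, Edge₁]; omega, by omega⟩
  · obtain ⟨u, hu⟩ := χ.exists_at (χ.x v).a₁ (χ.x v).a₂ (χ.x v).a₃ (χ.x v).d₁ ((χ.x v).d₂ - 1)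
      ((χ.x v).l + 1) (by simp only [Valid]; omega)
    simp only [At] at hu
    exact ⟨1, by simp, u, by simp only [χ.edge₁, Edge₁]; omega, by omega⟩

lemma exists_bottom (v : K.V) :
    ∃ b, χ.At b (χ.x v).a₁ (χ.x v).a₂ (χ.x v).a₃ (-(χ.x v).a₂) (-(χ.x v).a₃) 0 ∧
      inComp K (Set.Icc 1 2) b v := by
  obtain ⟨n, hn⟩ : ∃ n : ℕ, ((χ.x v).a₂ + 2 * (χ.x v).a₃ +
    ((χ.x v).d₁ + 2 * (χ.x v).d₂ + (χ.x v).l)).toNat = n := ⟨_, rfl⟩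
  induction n using Nat.strong_induction_on generalizing v with
  | _ n ih =>
  by_cases hv : χ.At v (χ.x v).a₁ (χ.x v).a₂ (χ.x v).a₃ (-(χ.x v).a₂) (-(χ.x v).a₃) 0
  · exact ⟨v, hv, .refl⟩
  obtain ⟨i, hi, u, e, hu⟩ := exists_pred v hv
  have step : inComp K (Set.Icc 1 2) u v := .single ⟨i, hi, .inl e⟩
  obtain ⟨h₁, h₂, h₃⟩ := eq_of_inComp_upper (χ := χ) step
  have hval := χ.valid u
  simp only [Valid] at hval
  obtain ⟨b, hb, r⟩ := ih _ (by omega) u rfl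
  rw [← h₁, ← h₂, ← h₃] at hb
  exact ⟨b, hb, r.trans step⟩

lemma inComp_upper_iff (χ : Chart K c₁ c₂) {u v : K.V} : inComp K (Set.Icc 1 2) u v ↔
    (χ.x v).a₁ = (χ.x u).a₁ ∧ (χ.x v).a₂ = (χ.x u).a₂ ∧ (χ.x v).a₃ = (χ.x u).a₃ := by
  refine ⟨eq_of_inComp_upper, fun ⟨h₁, h₂, h₃⟩ => ?_⟩
  obtain ⟨b, hb, r⟩ := χ.exists_bottom u
  obtain ⟨b', hb', r'⟩ := χ.exists_bottom v
  rw [h₁, h₂, h₃] at hb'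
  rw [hb.unique hb'] at r
  exact r.symm.trans r'

lemma at_of_isSource_sub {r : K.V} {s : (K.sub (Set.Icc 1 2) r).V}
    (hs : IsSource (K.sub (Set.Icc 1 2) r) s) :
    χ.At s.1 (χ.x r).a₁ (χ.x r).a₂ (χ.x r).a₃ (-(χ.x r).a₂) (-(χ.x r).a₃) 0 := by
  obtain ⟨h₁, h₂, h₃⟩ := (χ.inComp_upper_iff).1 s.2
  by_contra hne
  rw [← h₁, ← h₂, ← h₃] at hne
  obtain ⟨i, hi, u, e, -⟩ := exists_pred s.1 hne
  have hu : inComp K (Set.Icc 1 2) r u := s.2.tail ⟨i, hi, .inr e⟩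
  exact hs i ⟨u, hu⟩ (sub_edge.2 ⟨hi, e⟩)

lemma exists_isSource_sub (χ : Chart K c₁ c₂) (r : K.V) :
    ∃ s, IsSource (K.sub (Set.Icc 1 2) r) s := by
  obtain ⟨b, hb, hr⟩ := χ.exists_bottom r
  refine ⟨⟨b, hr.symm⟩, fun i u e => ?_⟩
  obtain ⟨hi, e⟩ := sub_edge.1 e
  have hval := χ.valid u.1
  have : i = 1 ∨ i = 2 := by rw [Set.mem_Icc] at hi; omega
  simp only [Valid, At] at hval hb
  rcases this with rfl | rfl
  · simp only [χ.edge₁, Edge₁] at e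
    omega
  · simp only [χ.edge₂, Edge₂] at e
    omega

lemma inComp_middle_iff (χ : Chart K c₁ c₂) {u v : K.V} : inComp K {2} u v ↔
    (χ.x v).a₁ = (χ.x u).a₁ ∧ (χ.x v).a₂ = (χ.x u).a₂ ∧ (χ.x v).a₃ = (χ.x u).a₃ ∧
    (χ.x v).d₁ = (χ.x u).d₁ ∧ (χ.x v).d₂ = (χ.x u).d₂ := by
  constructor
  · intro h
    induction h with
    | refl => simp
    | tail _ e ih =>
      obtain ⟨i, hi, e⟩ := e
      rw [Set.mem_singleton_iff] at hi
      subst hi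
      simp only [χ.edge₂, Edge₂] at e
      omega
  · have key : ∀ (n : ℕ) (u v : K.V), χ.At v (χ.x u).a₁ (χ.x u).a₂ (χ.x u).a₃ (χ.x u).d₁
        (χ.x u).d₂ ((χ.x u).l + n) → inComp K {2} u v := by
      intro n
      induction n with
      | zero =>
        intro u v hv
        have hu : χ.At u (χ.x u).a₁ (χ.x u).a₂ (χ.x u).a₃ (χ.x u).d₁ (χ.x u).d₂
          ((χ.x u).l + (0 : ℕ)) := by simp [At]
        exact hu.unique hv ▸ .refl
      | succ n ih =>
        intro u v hv
        have hvu := χ.valid u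
        have hvv := χ.valid v
        simp only [Valid, At, Nat.cast_succ] at hvu hvv hv
        obtain ⟨w, hw⟩ := χ.exists_at (χ.x u).a₁ (χ.x u).a₂ (χ.x u).a₃ (χ.x u).d₁ (χ.x u).d₂
          ((χ.x u).l + n) (by simp only [Valid]; omega)
        refine (ih u w hw).tail ⟨2, rfl, .inl ?_⟩
        simp only [χ.edge₂, Edge₂, At] at *
        omega
    rintro ⟨h₁, h₂, h₃, h₄, h₅⟩
    rcases le_total (χ.x u).l (χ.x v).l with hl | hl
    · exact key ((χ.x v).l - (χ.x u).l).toNat u v (by unfold At; omega)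
    · exact (key ((χ.x u).l - (χ.x v).l).toNat v u (by unfold At; omega)).symm

end Chart
/-! ### Charts of symmetric crystals and descriptions of self-complementary vertices -/

lemma Coord.mirror_eq_self_iff {x : Coord} :
    x.mirror = x ↔ x.a₃ = x.a₁ + max x.d₁ 0 ∧ x.d₂ = -x.d₁ := by
  simp only [Coord.ext_iff, Coord.mirror, and_true]
  omega

section Symmetric

variable {K : PreGraph} {s : K.V}

/-- A color-reversing bijection fixes the source. -/
lemma fixes_source (hK : IsACrystal 3 K) (hs : IsSource K s) {σ : K.V → K.V}
    (hσb : Function.Surjective σ)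
    (hσ : ∀ (i : ℕ) (u v : K.V), K.F i u = some v ↔ K.F (4 - i) (σ u) = some (σ v)) :
    σ s = s := by
  have : Finite K.V := hK.1.1
  obtain ⟨n, r⟩ := hK.regular.reach_of_isSource hK.2.1 hs (σ s)
  generalize hw : σ s = w at r
  cases r with
  | base => rfl
  | @step n u v i r e =>
    obtain ⟨u, rfl⟩ := hσb u
    subst hw
    have hi := hK.regular.col e
    unfold Col at hi
    refine absurd ((hσ (4 - i) u s).2 ?_) (hs _ _)
    rwa [show 4 - (4 - i) = i by omega]

/-- Every symmetric crystal has a chart, in which a color-reversing bijection is `Coord.mirror`. -/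
lemma exists_chart (hK : IsACrystal 3 K) (hs : IsSource K s) {c : ℕ → ℕ}
    (hc : ∀ i, 1 ≤ i → i ≤ 3 → K.h i s = c i) (hsym : c 3 = c 1) {σ : K.V → K.V}
    (hσb : Function.Surjective σ)
    (hσ : ∀ (i : ℕ) (u v : K.V), K.F i u = some v ↔ K.F (4 - i) (σ u) = some (σ v)) :
    ∃ χ : Chart K (c 1) (c 2), χ.At s 0 0 0 0 0 0 ∧ ∀ v, χ.x (σ v) = (χ.x v).mirror := by
  have : Finite K.V := hK.1.1
  have h₁ : (0 : ℤ) ≤ c 1 := by omega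
  have h₂ : (0 : ℤ) ≤ c 2 := by omega
  have hr := hK.regular.reach_of_isSource hK.2.1 hs
  have ht : ∀ i, K.t i s = 0 := by
    intro i
    by_contra hne
    obtain ⟨u, e⟩ := hK.1.exists_of_t_pos (Nat.pos_of_ne_zero hne)
    exact hs i u e
  obtain ⟨φ, φs, hφ⟩ := exists_iso hK.regular (Model.regular (c 1) (c 2)) hr
    (Model.exists_reach h₁ h₂) (by
      intro i hi
      have hi' : i = 1 ∨ i = 2 ∨ i = 3 := by unfold Col at hi; omega
      rw [ht, hc i hi.1 hi.2]
      rcases hi' with rfl | rfl | rfl <;> simp [Model.h, Model.t, Model.origin, hsym])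
  refine ⟨⟨fun v => (φ v).1, fun u v e => φ.injective (Subtype.ext e), fun v => (φ v).2,
    fun y hy => ⟨φ.symm ⟨y, hy⟩, congrArg Subtype.val (φ.apply_symm_apply _)⟩, fun {u v} => (hφ 1 u v).trans Model.edge₁,
    fun {u v} => (hφ 2 u v).trans Model.edge₂, fun {u v} => (hφ 3 u v).trans Model.edge₃⟩, ?_, ?_⟩
  · simp [Chart.At, φs, Model.origin]
  · intro v
    suffices φ (σ v) = Model.inv (φ v) from congrArg Subtype.val this
    obtain ⟨n, r⟩ := hr v
    induction r with
    | base =>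
      rw [fixes_source hK hs hσb hσ, φs]
      exact Subtype.ext (by simp [Model.inv, Model.origin, Coord.mirror])
    | @step n u v i _ e ih =>
      have e₁ := (hφ _ _ _).1 ((hσ i u v).1 e)
      have e₂ := Model.edge_inv_of_edge ((hφ i u v).1 e)
      rw [ih, e₂] at e₁
      exact (Option.some.inj e₁).symm

end Symmetric

namespace Chart

variable {K : PreGraph} {s v : K.V}

lemma t_two_eq {c₁ c₂ : ℤ} (χ : Chart K c₁ c₂) {C : Set ℕ} (hK : IsColored K C) (v : K.V) :
    (K.t 2 v : ℤ) = (χ.x v).l := by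
  obtain ⟨n, hn⟩ : ∃ n : ℕ, K.t 2 v = n := ⟨_, rfl⟩
  have hv := χ.valid v
  induction n generalizing v with
  | zero =>
    by_contra hne
    simp only [Valid] at hv
    obtain ⟨u, hu⟩ := χ.exists_at (χ.x v).a₁ (χ.x v).a₂ (χ.x v).a₃ (χ.x v).d₁ (χ.x v).d₂
      ((χ.x v).l - 1) (by simp only [Valid]; omega)
    have e : K.F 2 u = some v := by
      simp only [χ.edge₂, Edge₂, At] at *
      omega
    have := hK.t_step e
    omega
  | succ n ih =>
    obtain ⟨u, e⟩ := hK.exists_of_t_pos (i := 2) (v := v) (by omega)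
    have ht := hK.t_step e
    have := ih u (by omega) (χ.valid u)
    simp only [χ.edge₂, Edge₂] at e
    omega

lemma isDescB_iff {c : ℕ → ℕ} {C : Set ℕ} (χ : Chart K (c 1) (c 2)) (hs : χ.At s 0 0 0 0 0 0)
    (hK : IsColored K C) (hsym : c 3 = c 1) {q : ℕ × ℕ × ℤ × ℕ} :
    IsDescB K s c v q ↔
      χ.At v q.1 q.2.1 (q.1 + max q.2.2.1 0) q.2.2.1 (-q.2.2.1) q.2.2.2 := by
  obtain ⟨a₁, a₂, δ, l⟩ := q
  have ht := χ.t_two_eq hK v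
  constructor
  · rintro ⟨hl, a, pa, ha₁, ha₂, ha₃, -, hpa, hv, hδ₁, hδ₂, s', hs', z, hz, hzv⟩
    have hp := at_of_isPrin hs hpa
    have hz := at_of_isPrin_sub (at_of_isSource_sub (χ := χ) hs') hz
    have hzv := χ.inComp_middle_iff.1 hzv
    simp only [At, if_true, OfNat.ofNat_ne_one, if_false] at *
    omega
  · intro hat
    have hval := χ.valid v
    simp only [At, Valid] at hat hval
    set a : ℕ → ℕ := fun i => if i = 1 then a₁ else if i = 2 then a₂ else (a₁ + max δ 0).toNat
      with ha
    have ha₁ : a 1 = a₁ := by simp [ha]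
    have ha₂ : a 2 = a₂ := by simp [ha]
    have ha₃ : a 3 = (a₁ + max δ 0).toNat := by simp [ha]
    obtain ⟨pa, hpa⟩ := exists_isPrin (a := a) hs (by omega) (by omega) (by omega)
    have hp := at_of_isPrin hs hpa
    obtain ⟨s', hs'⟩ := χ.exists_isSource_sub pa
    have hs'' := at_of_isSource_sub (χ := χ) hs'
    simp only [At] at hp
    obtain ⟨z, hz⟩ := exists_isPrin_sub (p := fun i => if i = 1 then ((a₂ : ℤ) + δ).toNat
      else ((a 3 : ℤ) - δ).toNat) hs''
      (by simp only [if_true]; omega) (by simp only [OfNat.ofNat_ne_one, if_false]; omega)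
    have hzat := at_of_isPrin_sub hs'' hz
    refine ⟨by simp only; omega, a, pa, ha₁, ha₂, ha₃, ?_, hpa, ?_, by simp only; omega,
      by simp only; omega, s', hs', z, hz, ?_⟩
    · intro i hi₁ hi₂
      have : i = 1 ∨ i = 2 ∨ i = 3 := by omega
      rcases this with rfl | rfl | rfl <;> omega
    · rw [χ.inComp_upper_iff]
      omega
    · rw [χ.inComp_middle_iff]
      simp only [At, if_true, OfNat.ofNat_ne_one, if_false] at hzat
      omega

end Chart
/-- every self-complementary vertex `v` of a symmetric `A_3`-crystal has a
(unique) description `(a_1, a_2, δ, l)` — in particular its deviation has the form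
`(δ, -δ)` and `a_3 = a_1 + δ⁺` — and `v ↦ (a_1, a_2, δ, l)` is a bijection from `S` onto
the set of integer quadruples satisfying `0 ≤ a_1 ≤ c_1`, `0 ≤ a_2 ≤ c_2`, `-a_2 ≤ δ`,
`a_2 - c_2 ≤ δ`, `δ ≤ c_1 - a_1` and `0 ≤ l ≤ c_2 + 2δ`. -/
theorem A3_descriptions_biject
    (K : PreGraph) (hK : IsACrystal 3 K)
    (s : K.V) (hs : IsSource K s)
    (c : ℕ → ℕ) (hc : ∀ i, 1 ≤ i → i ≤ 3 → K.h i s = c i) (hsym : c 3 = c 1)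
    (σ : K.V → K.V) (hσb : Function.Bijective σ)
    (hσ : ∀ (i : ℕ) (u v : K.V), K.F i u = some v ↔ K.F (4 - i) (σ u) = some (σ v)) :
    (∀ v : K.V, σ v = v → ∃! q : ℕ × ℕ × ℤ × ℕ, IsDescB K s c v q) ∧
    (∀ v : K.V, σ v = v → ∀ q, IsDescB K s c v q → q ∈ QuadB (c 1) (c 2)) ∧
    (∀ q ∈ QuadB (c 1) (c 2), ∃! v : K.V, σ v = v ∧ IsDescB K s c v q) := by
  obtain ⟨χ, hχ, hm⟩ := exists_chart hK hs hc hsym hσb.2 hσ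
  have hfix : ∀ v, σ v = v ↔
      (χ.x v).a₃ = (χ.x v).a₁ + max (χ.x v).d₁ 0 ∧ (χ.x v).d₂ = -(χ.x v).d₁ := fun v => by
    rw [← χ.inj.eq_iff, hm, Coord.mirror_eq_self_iff]
  have hdesc : ∀ v q, IsDescB K s c v q ↔ _ := fun v q => χ.isDescB_iff hχ hK.1 hsym
  simp only [hdesc, hfix]
  refine ⟨fun v hv => ?_, fun v _ q hq => ?_, fun q hq => ?_⟩
  · have hval := χ.valid v
    unfold Coord.Valid at hval
    refine ⟨⟨(χ.x v).a₁.toNat, (χ.x v).a₂.toNat, (χ.x v).d₁, (χ.x v).l.toNat⟩, ?_, ?_⟩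
    · simp only [Chart.At, true_and]
      omega
    · rintro ⟨a₁, a₂, δ, l⟩ hq
      simp only [Chart.At, Prod.mk.injEq] at hq ⊢
      omega
  · have hval := χ.valid v
    simp only [Coord.Valid, Chart.At, QuadB, Set.mem_ofPred_eq] at *
    omega
  · simp only [QuadB, Set.mem_ofPred_eq] at hq
    obtain ⟨v, hv⟩ := χ.exists_at q.1 q.2.1 (q.1 + max q.2.2.1 0) q.2.2.1 (-q.2.2.1) q.2.2.2
      (by simp only [Coord.Valid]; omega)
    refine ⟨v, ⟨?_, hv⟩, fun u hu => hu.2.unique hv⟩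
    unfold Chart.At at hv
    omega
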